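/- Let X ∼ μ be a Borel probability measure on ℝ^d with E[X] = 0 and E‖X‖² < ∞. Define τ₁ = E[‖X‖·1_{‖X‖>1}], τ₂ = (E[‖X‖²·1_{‖X‖>1}])^{1/2}, X̃ = X·1_{‖X‖≤1} − E[X·1_{‖X‖≤1}], and Σ̃ = Cov(X̃). Let c₄ = (e⁴ − 5)/16. Then W₁(μ * γ, γ) ≤ (τ₁ + min(1,τ₁)) + √(2 log(1 + c₄ ‖Σ̃‖_F²)) and W₂(μ * γ, γ) ≤ (τ₂ + min(1,τ₂)) + √(2 log(1 + c₄ ‖Σ̃‖_F²)). In particular W₁(μ * γ, γ) ≤ 2τ₁ + √(2 log(1 + c₄ ‖Σ̃‖_F²)) and W₂(μ * γ, γ) ≤ 2τ₂ + √(2 log(1 + c₄ ‖Σ̃‖_F²)). -/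

import Mathlib

open MeasureTheory ProbabilityTheory Real ENNReal RealInnerProductSpace

noncomputable section

/-- The set of couplings of two measures `μ` and `ν`. -/
def couplings {E : Type*} [MeasurableSpace E] (μ ν : Measure E) : Set (Measure (E × E)) :=
  {τ | τ.map Prod.fst = μ ∧ τ.map Prod.snd = ν}

/-- The Wasserstein-`p` distance, valued in `ℝ≥0∞`:
`W_p(μ,ν) = (inf over couplings τ of ∫ ‖z₁ - z₂‖^p dτ)^{1/p}`. -/
noncomputable def Wp {E : Type*} [MeasurableSpace E] [NormedAddCommGroup E]
    (p : ℝ) (μ ν : Measure E) : ℝ≥0∞ :=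
  (⨅ τ ∈ couplings μ ν, ∫⁻ z : E × E, ENNReal.ofReal (‖z.1 - z.2‖ ^ p) ∂τ) ^ (1 / p)

/-- The standard Gaussian measure `N(0, I_d)` on `ℝ^d`. -/
noncomputable def stdGaussian (d : ℕ) : Measure (EuclideanSpace ℝ (Fin d)) :=
  (Measure.pi fun _ : Fin d => gaussianReal 0 1).map
    ((EuclideanSpace.equiv (Fin d) ℝ).symm : (Fin d → ℝ) → EuclideanSpace ℝ (Fin d))

/-- The Gaussian measure `N(m, I_d)` on `ℝ^d`. -/
noncomputable def gaussianE (d : ℕ) (m : EuclideanSpace ℝ (Fin d)) :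
    Measure (EuclideanSpace ℝ (Fin d)) :=
  (stdGaussian d).map (fun x => m + x)

/-- `C_p = (E_{ξ ∼ N(0,1)} |ξ|^p)^{1/p}`. -/
noncomputable def Cconst (p : ℝ) : ℝ := (∫ ξ : ℝ, |ξ| ^ p ∂(gaussianReal 0 1)) ^ (1 / p)

/-- `K_p = max {1, C_p/2 + 1/3}`. -/
noncomputable def Kconst (p : ℝ) : ℝ := max 1 (Cconst p / 2 + 1 / 3)

/-- The constant `c₄ = (e⁴ - 5)/16`. -/
noncomputable def cFour : ℝ := (Real.exp 4 - 5) / 16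

/-- The (second-moment) covariance matrix `∫ x xᵀ dμ` of a (centred) measure on `ℝ^d`. -/
noncomputable def covMat {d : ℕ} (μ : Measure (EuclideanSpace ℝ (Fin d))) :
    Matrix (Fin d) (Fin d) ℝ :=
  Matrix.of fun i j => ∫ x, x i * x j ∂μ

/-- The Frobenius norm of a matrix. -/
noncomputable def frob {d : ℕ} (A : Matrix (Fin d) (Fin d) ℝ) : ℝ :=
  Real.sqrt (∑ i, ∑ j, (A i j) ^ 2)

/-- `τ₁ = E[‖X‖ 1_{‖X‖ > 1}]`. -/
noncomputable def tailOne {d : ℕ} (μ : Measure (EuclideanSpace ℝ (Fin d))) : ℝ :=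
  ∫ x in {x : EuclideanSpace ℝ (Fin d) | 1 < ‖x‖}, ‖x‖ ∂μ

/-- `τ₂ = (E[‖X‖² 1_{‖X‖ > 1}])^{1/2}`. -/
noncomputable def tailTwo {d : ℕ} (μ : Measure (EuclideanSpace ℝ (Fin d))) : ℝ :=
  Real.sqrt (∫ x in {x : EuclideanSpace ℝ (Fin d) | 1 < ‖x‖}, ‖x‖ ^ 2 ∂μ)

/-- `m = E[X 1_{‖X‖ ≤ 1}]`. -/
noncomputable def truncMean {d : ℕ} (μ : Measure (EuclideanSpace ℝ (Fin d))) :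
    EuclideanSpace ℝ (Fin d) :=
  ∫ x in {x : EuclideanSpace ℝ (Fin d) | ‖x‖ ≤ 1}, x ∂μ

/-- `X̃ = X 1_{‖X‖ ≤ 1} - E[X 1_{‖X‖ ≤ 1}]`, as a function of `X`. -/
noncomputable def truncCentred {d : ℕ} (μ : Measure (EuclideanSpace ℝ (Fin d)))
    (x : EuclideanSpace ℝ (Fin d)) : EuclideanSpace ℝ (Fin d) :=
  (if ‖x‖ ≤ 1 then x else 0) - truncMean μ

/-- `Σ̃ = Cov(X̃) = E[X̃ X̃ᵀ]` (note `X̃` is centred). -/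
noncomputable def truncCov {d : ℕ} (μ : Measure (EuclideanSpace ℝ (Fin d))) :
    Matrix (Fin d) (Fin d) ℝ :=
  Matrix.of fun i j => ∫ x, truncCentred μ x i * truncCentred μ x j ∂μ

/-- The chi-squared divergence `χ²(ρ ‖ γ) = ∫ ((dρ/dγ) - 1)² dγ`. -/
noncomputable def chiSqDiv {E : Type*} [MeasurableSpace E] (ρ γm : Measure E) : ℝ :=
  ∫ x, ((ρ.rnDeriv γm x).toReal - 1) ^ 2 ∂γm

/-- The Kullback–Leibler divergence `KL(ρ ‖ γ) = ∫ log (dρ/dγ) dρ`. -/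
noncomputable def klDivReal {E : Type*} [MeasurableSpace E] (ρ γm : Measure E) : ℝ :=
  ∫ x, Real.log ((ρ.rnDeriv γm x).toReal) ∂ρ

/-- The Jacobian matrix `∇φ(x)` of a map `φ : ℝ^d → ℝ^d`, with entry `(i,j)` equal to
`∂φ_i/∂x_j (x)`. -/
noncomputable def jacobianM {d : ℕ}
    (φ : EuclideanSpace ℝ (Fin d) → EuclideanSpace ℝ (Fin d))
    (x : EuclideanSpace ℝ (Fin d)) : Matrix (Fin d) (Fin d) ℝ :=
  Matrix.of fun i j => fderiv ℝ φ x (EuclideanSpace.single j (1 : ℝ)) i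

/-- `τ` is a Stein kernel for the centred measure `ρ` relative to the standard Gaussian:
for all `φ ∈ C_c^∞(ℝ^d; ℝ^d)`, `E⟨X, φ(X)⟩ = E[tr(τ(X) ∇φ(X))]`. -/
def IsSteinKernel {d : ℕ} (ρ : Measure (EuclideanSpace ℝ (Fin d)))
    (τ : EuclideanSpace ℝ (Fin d) → Matrix (Fin d) (Fin d) ℝ) : Prop :=
  ∀ φ : EuclideanSpace ℝ (Fin d) → EuclideanSpace ℝ (Fin d),
    ContDiff ℝ (⊤ : ℕ∞) φ → HasCompactSupport φ →
      ∫ x, ⟪x, φ x⟫ ∂ρ = ∫ x, Matrix.trace (τ x * jacobianM φ x) ∂ρ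

section GaussianTransport

open Filter Topology Set NNReal

local notation "γ₁" => gaussianReal 0 1

/-- `f` is positive and `log f` is `A`-Lipschitz. -/
structure IsLogLipschitz {X : Type*} [PseudoMetricSpace X] (A : ℝ) (f : X → ℝ) : Prop where
  nonneg : 0 ≤ A
  pos : ∀ x, 0 < f x
  le : ∀ x y, f x ≤ Real.exp (A * dist x y) * f y

namespace IsLogLipschitz

variable {X : Type*} [PseudoMetricSpace X] {A : ℝ} {f : X → ℝ}

lemma log_le (hf : IsLogLipschitz A f) (x y : X) :
    Real.log (f x) ≤ A * dist x y + Real.log (f y) := by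
  rw [← Real.log_exp (A * dist x y), ← Real.log_mul (Real.exp_pos _).ne' (hf.pos y).ne']
  exact Real.log_le_log (hf.pos x) (hf.le x y)

lemma abs_log_le (hf : IsLogLipschitz A f) (x y : X) :
    |Real.log (f x)| ≤ |Real.log (f y)| + A * dist x y := by
  have h1 := hf.log_le x y
  have h2 := hf.log_le y x
  rw [dist_comm y x] at h2
  refine abs_le.2 ⟨?_, ?_⟩
  · linarith [neg_abs_le (Real.log (f y))]
  · linarith [le_abs_self (Real.log (f y))]

lemma continuous (hf : IsLogLipschitz A f) : Continuous f := by
  have h : LipschitzWith (Real.toNNReal A) fun x => Real.log (f x) := by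
    refine LipschitzWith.of_le_add_mul _ fun x y => ?_
    rw [Real.coe_toNNReal _ hf.nonneg]
    linarith [hf.log_le x y]
  refine (Real.continuous_exp.comp h.continuous).congr fun x => ?_
  exact Real.exp_log (hf.pos x)

end IsLogLipschitz

lemma integrable_exp_mul_abs_gaussianReal (t : ℝ) :
    Integrable (fun x : ℝ => Real.exp (t * |x|)) γ₁ := by
  refine integrable_exp_mul_abs (X := fun x => x) (integrable_exp_mul_gaussianReal t) ?_
  simpa using integrable_exp_mul_gaussianReal (μ := 0) (v := 1) (-t)

lemma gaussianPDFReal_zero_one (x : ℝ) :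
    gaussianPDFReal 0 1 x = (√(2 * π))⁻¹ * Real.exp (-(x ^ 2 / 2)) := by
  simp [gaussianPDFReal, neg_div]

lemma integrable_gaussianReal_iff (g : ℝ → ℝ) :
    Integrable g γ₁ ↔ Integrable fun x => gaussianPDFReal 0 1 x * g x := by
  rw [gaussianReal_of_var_ne_zero _ one_ne_zero,
    integrable_withDensity_iff_integrable_smul' (measurable_gaussianPDF 0 1)
      (ae_of_all _ fun _ => gaussianPDF_lt_top)]
  simp [toReal_gaussianPDF]

/-- The distribution function of the measure with density `g` with respect to `N(0,1)`. -/
def gaussCDF (g : ℝ → ℝ) (t : ℝ) : ℝ := ∫ s in Iic t, g s ∂γ₁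

lemma gaussCDF_eq (g : ℝ → ℝ) (t : ℝ) :
    gaussCDF g t = ∫ s in Iic t, gaussianPDFReal 0 1 s * g s := by
  rw [gaussCDF, ← integral_indicator measurableSet_Iic, ← integral_indicator measurableSet_Iic,
    integral_gaussianReal_eq_integral_smul one_ne_zero]
  congr 1 with x
  by_cases hx : x ∈ Iic t <;> simp [hx]

lemma continuous_gaussianPDFReal : Continuous (gaussianPDFReal 0 1) := by
  simp only [funext gaussianPDFReal_zero_one]
  fun_prop

lemma hasStrictDerivAt_gaussCDF {g : ℝ → ℝ} (hg : Continuous g) (hgi : Integrable g γ₁) (t : ℝ) :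
    HasStrictDerivAt (gaussCDF g) (gaussianPDFReal 0 1 t * g t) t := by
  have hi := (integrable_gaussianReal_iff g).1 hgi
  have hc : Continuous fun x => gaussianPDFReal 0 1 x * g x := continuous_gaussianPDFReal.mul hg
  have h : gaussCDF g = fun u => gaussCDF g 0 + ∫ s in (0 : ℝ)..u, gaussianPDFReal 0 1 s * g s := by
    ext u
    rw [gaussCDF_eq, gaussCDF_eq, ← intervalIntegral.integral_Iic_sub_Iic hi.integrableOn
      hi.integrableOn]
    ring
  rw [h]
  exact (intervalIntegral.integral_hasStrictDerivAt_right (hc.intervalIntegrable _ _)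
    (hc.stronglyMeasurableAtFilter _ _) hc.continuousAt).const_add _

lemma gaussCDF_strictMono {g : ℝ → ℝ} (hg : Continuous g) (hgi : Integrable g γ₁)
    (hpos : ∀ x, 0 < g x) : StrictMono (gaussCDF g) := by
  refine strictMono_of_deriv_pos fun t => ?_
  rw [(hasStrictDerivAt_gaussCDF hg hgi t).hasDerivAt.deriv]
  exact mul_pos (gaussianPDFReal_pos _ _ _ one_ne_zero) (hpos t)

lemma gaussCDF_tendsto_atTop {g : ℝ → ℝ} (hgi : Integrable g γ₁) (h1 : ∫ x, g x ∂γ₁ = 1) :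
    Tendsto (gaussCDF g) atTop (𝓝 1) := by
  rw [← h1]
  exact (aecover_Iic tendsto_id).integral_tendsto_of_countably_generated hgi

lemma gaussCDF_tendsto_atBot {g : ℝ → ℝ} (hgi : Integrable g γ₁) (h1 : ∫ x, g x ∂γ₁ = 1) :
    Tendsto (gaussCDF g) atBot (𝓝 0) := by
  have h : ∀ t, gaussCDF g t = 1 - ∫ s in Ioi t, g s ∂γ₁ := fun t => by
    rw [gaussCDF, ← h1, ← integral_add_compl measurableSet_Iic hgi, compl_Iic]
    ring
  have h2 : Tendsto (fun t => ∫ s in Ioi t, g s ∂γ₁) atBot (𝓝 (∫ s, g s ∂γ₁)) :=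
    (aecover_Ioi tendsto_id).integral_tendsto_of_countably_generated hgi
  rw [h1] at h2
  simpa [funext h] using h2.const_sub 1

/-- A probability density with respect to `N(0,1)` whose logarithm is Lipschitz. -/
structure IsGaussDensity (A : ℝ) (g : ℝ → ℝ) : Prop extends IsLogLipschitz A g where
  integral_eq_one : ∫ x, g x ∂γ₁ = 1

lemma IsLogLipschitz.integrable_gaussianReal {A : ℝ} {g : ℝ → ℝ} (hg : IsLogLipschitz A g) :
    Integrable g γ₁ := by
  refine ((integrable_exp_mul_abs_gaussianReal A).mul_const (g 0)).mono'
    hg.continuous.aestronglyMeasurable (ae_of_all _ fun x => ?_)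
  rw [Real.norm_of_nonneg (hg.pos x).le]
  simpa using hg.le x 0

namespace IsGaussDensity

variable {A : ℝ} {g : ℝ → ℝ}

lemma integrable (hg : IsGaussDensity A g) : Integrable g γ₁ :=
  hg.toIsLogLipschitz.integrable_gaussianReal

lemma strictMono (hg : IsGaussDensity A g) : StrictMono (gaussCDF g) :=
  gaussCDF_strictMono hg.continuous hg.integrable hg.pos

lemma gaussCDF_mem_Ioo (hg : IsGaussDensity A g) (t : ℝ) : gaussCDF g t ∈ Ioo 0 1 := by
  have hm := hg.strictMono
  constructor
  · exact (hm.monotone.le_of_tendsto (gaussCDF_tendsto_atBot hg.integrable hg.integral_eq_one)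
      (t - 1)).trans_lt (hm (by linarith))
  · exact (hm (by linarith)).trans_le (hm.monotone.ge_of_tendsto
      (gaussCDF_tendsto_atTop hg.integrable hg.integral_eq_one) (t + 1))

lemma exists_gaussCDF_eq (hg : IsGaussDensity A g) {u : ℝ} (hu : u ∈ Ioo (0 : ℝ) 1) :
    ∃ t, gaussCDF g t = u := by
  have hc : Continuous (gaussCDF g) := continuous_iff_continuousAt.2 fun t =>
    (hasStrictDerivAt_gaussCDF hg.continuous hg.integrable t).hasDerivAt.continuousAt
  refine mem_range_of_exists_le_of_exists_ge hc ?_ ?_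
  · exact (((gaussCDF_tendsto_atBot hg.integrable hg.integral_eq_one).eventually
      (gt_mem_nhds hu.1)).exists).imp fun _ h => le_of_lt h
  · exact (((gaussCDF_tendsto_atTop hg.integrable hg.integral_eq_one).eventually
      (lt_mem_nhds hu.2)).exists).imp fun _ h => le_of_lt h

lemma one : IsGaussDensity 0 fun _ => 1 where
  nonneg := le_rfl
  pos _ := one_pos
  le _ _ := by simp
  integral_eq_one := by simp

end IsGaussDensity

/-- The increasing map pushing `N(0,1)` forward to the measure with density `g` with respect to
`N(0,1)`. -/
def gaussTransport (g : ℝ → ℝ) (x : ℝ) : ℝ :=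
  Function.invFun (gaussCDF g) (gaussCDF (fun _ => 1) x)

namespace IsGaussDensity

variable {A : ℝ} {g : ℝ → ℝ}

lemma gaussCDF_gaussTransport (hg : IsGaussDensity A g) (x : ℝ) :
    gaussCDF g (gaussTransport g x) = gaussCDF (fun _ => 1) x :=
  Function.invFun_eq (hg.exists_gaussCDF_eq (one.gaussCDF_mem_Ioo x))

lemma gaussTransport_le_iff (hg : IsGaussDensity A g) (x t : ℝ) :
    gaussTransport g x ≤ t ↔ gaussCDF (fun _ => 1) x ≤ gaussCDF g t := by
  rw [← hg.gaussCDF_gaussTransport, hg.strictMono.le_iff_le]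

lemma hasDerivAt_gaussTransport (hg : IsGaussDensity A g) (x : ℝ) :
    HasDerivAt (gaussTransport g)
      (gaussianPDFReal 0 1 x / (gaussianPDFReal 0 1 (gaussTransport g x) * g (gaussTransport g x)))
      x := by
  set u := gaussCDF (fun _ => 1) x with hu
  have humem : Ioo (0 : ℝ) 1 ∈ 𝓝 u := Ioo_mem_nhds (one.gaussCDF_mem_Ioo x).1
    (one.gaussCDF_mem_Ioo x).2
  have hinv : ∀ v ∈ Ioo (0 : ℝ) 1, gaussCDF g (Function.invFun (gaussCDF g) v) = v :=
    fun v hv => Function.invFun_eq (hg.exists_gaussCDF_eq hv)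
  have hmono : StrictMonoOn (Function.invFun (gaussCDF g)) (Ioo 0 1) := by
    intro v hv w hw hvw
    rw [← hg.strictMono.lt_iff_lt, hinv v hv, hinv w hw]
    exact hvw
  have hcont : ContinuousAt (Function.invFun (gaussCDF g)) u := by
    refine hmono.continuousAt_of_image_mem_nhds humem ?_
    convert univ_mem
    refine eq_univ_of_forall fun t => ⟨gaussCDF g t, hg.gaussCDF_mem_Ioo t, ?_⟩
    exact Function.leftInverse_invFun hg.strictMono.injective t
  have hd := HasDerivAt.of_local_left_inverse hcont
    (hasStrictDerivAt_gaussCDF hg.continuous hg.integrable _).hasDerivAt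
    (mul_pos (gaussianPDFReal_pos _ _ _ one_ne_zero) (hg.pos _)).ne'
    (eventually_of_mem humem hinv)
  have h1 := (hasStrictDerivAt_gaussCDF (g := fun _ => 1) continuous_const
    (integrable_const _) x).hasDerivAt
  have := HasDerivAt.comp x hd h1
  rw [mul_one] at this
  rw [div_eq_inv_mul]
  exact this

lemma continuous_gaussTransport (hg : IsGaussDensity A g) : Continuous (gaussTransport g) :=
  continuous_iff_continuousAt.2 fun x => (hg.hasDerivAt_gaussTransport x).continuousAt

lemma withDensity_Iic (hg : IsGaussDensity A g) (t : ℝ) :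
    (γ₁).withDensity (fun x => ENNReal.ofReal (g x)) (Iic t) = ENNReal.ofReal (gaussCDF g t) := by
  rw [withDensity_apply _ measurableSet_Iic, gaussCDF,
    ofReal_integral_eq_lintegral_ofReal hg.integrable.integrableOn
      (ae_of_all _ fun x => (hg.pos x).le)]

lemma map_gaussTransport (hg : IsGaussDensity A g) :
    (γ₁).map (gaussTransport g) = (γ₁).withDensity fun x => ENNReal.ofReal (g x) := by
  have hm := hg.continuous_gaussTransport.measurable
  have : IsProbabilityMeasure ((γ₁).map (gaussTransport g)) :=
    Measure.isProbabilityMeasure_map hm.aemeasurable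
  refine Measure.ext_of_Iic _ _ fun t => ?_
  obtain ⟨x, hx⟩ := one.exists_gaussCDF_eq (hg.gaussCDF_mem_Ioo t)
  have h := one.withDensity_Iic x
  rw [show (fun _ : ℝ => ENNReal.ofReal 1) = 1 from funext fun _ => ENNReal.ofReal_one,
    withDensity_one] at h
  rw [Measure.map_apply hm measurableSet_Iic, hg.withDensity_Iic, ← hx, ← h]
  congr 1 with y
  rw [mem_preimage, mem_Iic, mem_Iic, hg.gaussTransport_le_iff, ← hx, one.strictMono.le_iff_le]

end IsGaussDensity

lemma gaussianReal_map_const_add_eq_withDensity (c : ℝ) :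
    (γ₁).map (fun x => c + x) =
      (γ₁).withDensity fun x => ENNReal.ofReal (Real.exp (c * x - c ^ 2 / 2)) := by
  rw [gaussianReal_map_const_add, gaussianReal_of_var_ne_zero _ one_ne_zero,
    gaussianReal_of_var_ne_zero _ one_ne_zero,
    ← withDensity_mul _ (measurable_gaussianPDF 0 1) (by fun_prop)]
  congr 1 with x
  simp only [gaussianPDF, Pi.mul_apply]
  rw [← ENNReal.ofReal_mul (gaussianPDFReal_nonneg _ _ _), gaussianPDFReal_zero_one, mul_assoc,
    ← Real.exp_add]
  congr 1
  simp only [gaussianPDFReal, NNReal.coe_one, mul_one]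
  congr 2
  ring

lemma integrable_gaussianReal_of_le {h : ℝ → ℝ} (hc : Continuous h) (C B : ℝ)
    (hb : ∀ x, |h x| ≤ C * Real.exp (B * |x|)) : Integrable h γ₁ :=
  ((integrable_exp_mul_abs_gaussianReal B).const_mul C).mono' hc.aestronglyMeasurable
    (ae_of_all _ hb)

namespace IsGaussDensity

variable {A B : ℝ} {g p q : ℝ → ℝ}

lemma exp_tilt (c : ℝ) : IsGaussDensity |c| fun x => Real.exp (c * x - c ^ 2 / 2) where
  nonneg := abs_nonneg c
  pos _ := Real.exp_pos _
  le x y := by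
    rw [← Real.exp_add, Real.exp_le_exp, Real.dist_eq, ← abs_mul]
    linarith [le_abs_self (c * (x - y))]
  integral_eq_one := by
    have h := congrFun (mgf_fun_id_gaussianReal (μ := 0) (v := 1)) c
    simp only [mgf, zero_mul, zero_add, NNReal.coe_one, one_mul] at h
    simp only [Real.exp_sub, integral_div, h]
    exact div_self (Real.exp_pos _).ne'

lemma gaussCDF_exp_tilt (c t : ℝ) :
    gaussCDF (fun x => Real.exp (c * x - c ^ 2 / 2)) t = gaussCDF (fun _ => 1) (t - c) := by
  have h1 := (exp_tilt c).withDensity_Iic t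
  have h2 := one.withDensity_Iic (t - c)
  rw [show (fun _ : ℝ => ENNReal.ofReal 1) = 1 from funext fun _ => ENNReal.ofReal_one,
    withDensity_one] at h2
  rw [← gaussianReal_map_const_add_eq_withDensity,
    Measure.map_apply (by fun_prop) measurableSet_Iic,
    show (fun x => c + x) ⁻¹' Iic t = Iic (t - c) by ext x; simp [le_sub_iff_add_le'], h2] at h1
  exact ((ENNReal.ofReal_eq_ofReal_iff (one.gaussCDF_mem_Ioo _).1.le
    ((exp_tilt c).gaussCDF_mem_Ioo _).1.le).1 h1).symm

/-- A monotone likelihood ratio implies stochastic domination. -/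
lemma gaussCDF_le_of_ratio (hp : IsGaussDensity A p) (hq : IsGaussDensity B q)
    (h : ∀ s t, s ≤ t → q s * p t ≤ q t * p s) (y : ℝ) : gaussCDF q y ≤ gaussCDF p y := by
  rcases le_total (q y) (p y) with hy | hy
  · refine setIntegral_mono_on hq.integrable.integrableOn hp.integrable.integrableOn
      measurableSet_Iic fun s hs => ?_
    have := h s y hs
    refine le_of_mul_le_mul_right (this.trans ?_) (hp.pos y)
    rw [mul_comm (p s)]
    exact mul_le_mul_of_nonneg_right hy (hp.pos s).le
  · have h1 := integral_add_compl (measurableSet_Iic (a := y)) hp.integrable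
    have h2 := integral_add_compl (measurableSet_Iic (a := y)) hq.integrable
    rw [hp.integral_eq_one] at h1
    rw [hq.integral_eq_one] at h2
    have : ∫ x in (Iic y)ᶜ, p x ∂γ₁ ≤ ∫ x in (Iic y)ᶜ, q x ∂γ₁ := by
      refine setIntegral_mono_on hp.integrable.integrableOn hq.integrable.integrableOn
        measurableSet_Iic.compl fun s hs => ?_
      have hmeas : y ≤ s := le_of_lt (by simpa using hs)
      refine le_of_mul_le_mul_left (?_ : q y * p s ≤ q y * q s) (hq.pos y)
      refine (h y s hmeas).trans ?_
      rw [mul_comm (q y)]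
      exact mul_le_mul_of_nonneg_left hy (hq.pos s).le
    unfold gaussCDF
    linarith

/-- The monotone transport map onto a log-Lipschitz perturbation of `N(0,1)` has bounded
displacement. -/
lemma abs_gaussTransport_sub_le (hg : IsGaussDensity A g) (x : ℝ) :
    |gaussTransport g x - x| ≤ A := by
  have hle : ∀ s t, s ≤ t → g s ≤ Real.exp (A * (t - s)) * g t ∧
      g t ≤ Real.exp (A * (t - s)) * g s := fun s t hst => by
    have h1 := hg.le s t
    have h2 := hg.le t s
    rw [dist_comm, Real.dist_eq, abs_of_nonneg (sub_nonneg.2 hst)] at h1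
    rw [Real.dist_eq, abs_of_nonneg (sub_nonneg.2 hst)] at h2
    exact ⟨h1, h2⟩
  have h1 : gaussTransport g x ≤ x + A := by
    rw [hg.gaussTransport_le_iff]
    have := gaussCDF_le_of_ratio hg (exp_tilt A) (fun s t hst => ?_) (x + A)
    · rwa [gaussCDF_exp_tilt, add_sub_cancel_right] at this
    · refine (mul_le_mul_of_nonneg_left (hle s t hst).2 (Real.exp_pos _).le).trans_eq ?_
      rw [← mul_assoc, ← Real.exp_add]
      ring_nf
  have h2 : x ≤ gaussTransport g x + A := by
    have := gaussCDF_le_of_ratio (exp_tilt (-A)) hg (fun s t hst => ?_) (gaussTransport g x)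
    · rw [gaussCDF_exp_tilt, sub_neg_eq_add, hg.gaussCDF_gaussTransport] at this
      exact one.strictMono.le_iff_le.1 this
    · refine (mul_le_mul_of_nonneg_right (hle s t hst).1 (Real.exp_pos _).le).trans_eq ?_
      rw [mul_comm _ (g t), mul_assoc, ← Real.exp_add]
      ring_nf
  exact abs_le.2 ⟨by linarith, by linarith⟩

lemma abs_gaussTransport_le (hg : IsGaussDensity A g) (x : ℝ) :
    |gaussTransport g x| ≤ |x| + A := by
  have h := abs_add_le (gaussTransport g x - x) x
  rw [sub_add_cancel] at h
  linarith [hg.abs_gaussTransport_sub_le x]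

/-- The derivative of the transport map. -/
def transportDeriv (g : ℝ → ℝ) (x : ℝ) : ℝ :=
  Real.exp ((gaussTransport g x ^ 2 - x ^ 2) / 2) / g (gaussTransport g x)

lemma transportDeriv_pos (hg : IsGaussDensity A g) (x : ℝ) : 0 < transportDeriv g x :=
  div_pos (Real.exp_pos _) (hg.pos _)

lemma hasDerivAt_gaussTransport_exp (hg : IsGaussDensity A g) (x : ℝ) :
    HasDerivAt (gaussTransport g) (transportDeriv g x) x := by
  convert hg.hasDerivAt_gaussTransport x using 1
  have h0 : (√(2 * π))⁻¹ ≠ 0 := inv_ne_zero (by positivity)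
  rw [gaussianPDFReal_zero_one, gaussianPDFReal_zero_one, transportDeriv, mul_assoc,
    mul_div_mul_left _ _ h0, ← div_div, ← Real.exp_sub]
  ring_nf

lemma continuous_transportDeriv (hg : IsGaussDensity A g) : Continuous (transportDeriv g) := by
  have h := hg.continuous_gaussTransport
  exact (Real.continuous_exp.comp (by fun_prop)).div (hg.continuous.comp h) fun x => (hg.pos _).ne'

lemma transportDeriv_le (hg : IsGaussDensity A g) (x : ℝ) :
    transportDeriv g x ≤ Real.exp (3 * A ^ 2 / 2) / g 0 * Real.exp (2 * A * |x|) := by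
  have h0 := hg.le 0 (gaussTransport g x)
  rw [dist_comm, dist_zero_right, Real.norm_eq_abs] at h0
  rw [transportDeriv, div_le_iff₀ (hg.pos _), div_mul_eq_mul_div, div_mul_eq_mul_div,
    le_div_iff₀ (hg.pos 0)]
  refine (mul_le_mul_of_nonneg_left h0 (Real.exp_pos _).le).trans ?_
  rw [← mul_assoc]
  refine mul_le_mul_of_nonneg_right ?_ (hg.pos _).le
  rw [← Real.exp_add, ← Real.exp_add, Real.exp_le_exp]
  have h1 := hg.abs_gaussTransport_le x
  have h2 : gaussTransport g x ^ 2 - x ^ 2 ≤ A * (2 * |x| + A) := by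
    have := sq_le_sq' (by linarith [abs_nonneg (gaussTransport g x), abs_nonneg x, hg.nonneg]) h1
    rw [sq_abs] at this
    nlinarith [sq_abs x]
  nlinarith [mul_le_mul_of_nonneg_left h1 hg.nonneg]

lemma integrable_transportDeriv (hg : IsGaussDensity A g) : Integrable (transportDeriv g) γ₁ := by
  refine integrable_gaussianReal_of_le hg.continuous_transportDeriv
    (Real.exp (3 * A ^ 2 / 2) / g 0) (2 * A) fun x => ?_
  rw [abs_of_pos (hg.transportDeriv_pos x)]
  exact hg.transportDeriv_le x

lemma integrable_mul_gaussTransport_sub (hg : IsGaussDensity A g) :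
    Integrable (fun x => x * (gaussTransport g x - x)) γ₁ := by
  refine integrable_gaussianReal_of_le (by have := hg.continuous_gaussTransport; fun_prop) A 1
    fun x => ?_
  rw [abs_mul, mul_comm, one_mul]
  exact mul_le_mul (hg.abs_gaussTransport_sub_le x)
    ((le_add_of_nonneg_right zero_le_one).trans (Real.add_one_le_exp _)) (abs_nonneg _) hg.nonneg

lemma integrable_gaussTransport_sub_sq (hg : IsGaussDensity A g) :
    Integrable (fun x => (gaussTransport g x - x) ^ 2) γ₁ := by
  refine integrable_gaussianReal_of_le (by have := hg.continuous_gaussTransport; fun_prop) (A ^ 2) 0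
    fun x => ?_
  rw [abs_pow, zero_mul, Real.exp_zero, mul_one]
  exact pow_le_pow_left₀ (abs_nonneg _) (hg.abs_gaussTransport_sub_le x) 2

lemma integrable_log_gaussTransport (hg : IsGaussDensity A g) :
    Integrable (fun x => Real.log (g (gaussTransport g x))) γ₁ := by
  refine integrable_gaussianReal_of_le ?_ (|Real.log (g 0)| + A ^ 2 + A) 1 fun x => ?_
  · exact (hg.continuous.comp hg.continuous_gaussTransport).log fun x => (hg.pos _).ne'
  · have h := hg.abs_log_le (gaussTransport g x) 0
    rw [dist_zero_right, Real.norm_eq_abs] at h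
    have h1 := mul_le_mul_of_nonneg_left (hg.abs_gaussTransport_le x) hg.nonneg
    rw [one_mul]
    have h2 := Real.add_one_le_exp |x|
    have h3 := abs_nonneg x
    have h4 := abs_nonneg (Real.log (g 0))
    nlinarith [hg.nonneg, mul_nonneg h4 (by linarith : 0 ≤ Real.exp |x| - 1),
      mul_nonneg hg.nonneg (by linarith : 0 ≤ Real.exp |x| - |x|),
      mul_nonneg (sq_nonneg A) (by linarith : 0 ≤ Real.exp |x| - 1)]

/-- Gaussian integration by parts for the displacement of the transport map. -/
lemma integral_mul_gaussTransport_sub (hg : IsGaussDensity A g) :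
    ∫ x, x * (gaussTransport g x - x) ∂γ₁ = ∫ x, (transportDeriv g x - 1) ∂γ₁ := by
  have hd : ∀ x, HasDerivAt (fun x => gaussianPDFReal 0 1 x * (gaussTransport g x - x))
      (gaussianPDFReal 0 1 x * ((transportDeriv g x - 1) - x * (gaussTransport g x - x))) x := by
    intro x
    have h1 : HasDerivAt (gaussianPDFReal 0 1) (-x * gaussianPDFReal 0 1 x) x := by
      simp only [funext gaussianPDFReal_zero_one]
      have := (((hasDerivAt_pow 2 x).div_const 2).fun_neg.exp).const_mul (√(2 * π))⁻¹
      refine this.congr_deriv ?_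
      push_cast
      ring
    refine (h1.mul ((hg.hasDerivAt_gaussTransport_exp x).sub (hasDerivAt_id x))).congr_deriv ?_
    simp only [Pi.sub_apply, id]
    ring
  have hi1 : Integrable (fun x => transportDeriv g x - 1) γ₁ :=
    hg.integrable_transportDeriv.sub (integrable_const _)
  have hi := hi1.sub hg.integrable_mul_gaussTransport_sub
  have hi2 : Integrable (fun x => gaussTransport g x - x) γ₁ := by
    refine integrable_gaussianReal_of_le (by have := hg.continuous_gaussTransport; fun_prop) A 0
      fun x => ?_
    simpa using hg.abs_gaussTransport_sub_le x
  have h := integral_eq_zero_of_hasDerivAt_of_integrable hd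
    ((integrable_gaussianReal_iff _).1 hi) ((integrable_gaussianReal_iff _).1 hi2)
  have h' : ∫ x, ((transportDeriv g x - 1) - x * (gaussTransport g x - x)) ∂γ₁ = 0 := by
    rw [integral_gaussianReal_eq_integral_smul one_ne_zero]
    exact h
  rw [integral_sub hi1 hg.integrable_mul_gaussTransport_sub] at h'
  linarith

/-- **Talagrand's inequality** on the line: the cost of the monotone transport is at most twice the
relative entropy. -/
lemma integral_gaussTransport_sub_sq_le (hg : IsGaussDensity A g) :
    ∫ x, (gaussTransport g x - x) ^ 2 ∂γ₁ ≤ 2 * ∫ x, g x * Real.log (g x) ∂γ₁ := by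
  have hmap : ∫ x, g x * Real.log (g x) ∂γ₁ = ∫ x, Real.log (g (gaussTransport g x)) ∂γ₁ := by
    have h1 : ∫ x, Real.log (g (gaussTransport g x)) ∂γ₁ =
        ∫ y, Real.log (g y) ∂((γ₁).map (gaussTransport g)) :=
      (integral_map hg.continuous_gaussTransport.aemeasurable
        (hg.continuous.log fun x => (hg.pos _).ne').aestronglyMeasurable).symm
    rw [h1, hg.map_gaussTransport, integral_withDensity_eq_integral_toReal_smul
      hg.continuous.measurable.ennreal_ofReal (ae_of_all _ fun _ => ENNReal.ofReal_lt_top)]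
    exact integral_congr_ae (ae_of_all _ fun x => by
      simp [ENNReal.toReal_ofReal (hg.pos x).le])
  have hi1 : Integrable (fun x => transportDeriv g x - 1) γ₁ :=
    hg.integrable_transportDeriv.sub (integrable_const _)
  have hkey : ∀ x, (gaussTransport g x - x) ^ 2 ≤ 2 * (Real.log (g (gaussTransport g x)) +
      ((transportDeriv g x - 1) - x * (gaussTransport g x - x))) := by
    intro x
    have h1 := Real.log_le_sub_one_of_pos (hg.transportDeriv_pos x)
    have h2 : Real.log (transportDeriv g x) =
        (gaussTransport g x ^ 2 - x ^ 2) / 2 - Real.log (g (gaussTransport g x)) := by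
      rw [transportDeriv, Real.log_div (Real.exp_pos _).ne' (hg.pos _).ne', Real.log_exp]
    nlinarith
  have hi2 := hi1.sub hg.integrable_mul_gaussTransport_sub
  have hi3 := hg.integrable_log_gaussTransport.add hi2
  refine (integral_mono hg.integrable_gaussTransport_sub_sq (hi3.const_mul 2) hkey).trans_eq ?_
  rw [integral_const_mul, integral_add' hg.integrable_log_gaussTransport hi2,
    integral_sub' hi1 hg.integrable_mul_gaussTransport_sub, hg.integral_mul_gaussTransport_sub,
    hmap, sub_self, add_zero]

end IsGaussDensity

section ExpMoments

variable {X : Type*} [PseudoMetricSpace X] [MeasurableSpace X] [OpensMeasurableSpace X]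
  {m : Measure X} {x₀ : X} {A : ℝ} {f : X → ℝ}

lemma IsLogLipschitz.integrable (hf : IsLogLipschitz A f)
    (hm : ∀ B : ℝ, Integrable (fun x => Real.exp (B * dist x x₀)) m) : Integrable f m := by
  refine ((hm A).mul_const (f x₀)).mono' hf.continuous.aestronglyMeasurable
    (ae_of_all _ fun x => ?_)
  rw [Real.norm_of_nonneg (hf.pos x).le]
  exact hf.le x x₀

lemma IsLogLipschitz.integrable_mul_log (hf : IsLogLipschitz A f)
    (hm : ∀ B : ℝ, Integrable (fun x => Real.exp (B * dist x x₀)) m) :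
    Integrable (fun x => f x * Real.log (f x)) m := by
  refine ((hm (A + 1)).mul_const (f x₀ * (|Real.log (f x₀)| + A))).mono'
    (hf.continuous.mul (hf.continuous.log fun x => (hf.pos x).ne')).aestronglyMeasurable
    (ae_of_all _ fun x => ?_)
  rw [norm_mul, Real.norm_of_nonneg (hf.pos x).le, Real.norm_eq_abs, add_mul, one_mul, Real.exp_add]
  have h1 : |Real.log (f x)| ≤ (|Real.log (f x₀)| + A) * Real.exp (dist x x₀) := by
    have h2 := hf.abs_log_le x x₀
    have h3 := Real.add_one_le_exp (dist x x₀)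
    have h4 := dist_nonneg (x := x) (y := x₀)
    nlinarith [mul_nonneg (abs_nonneg (Real.log (f x₀)))
        (by linarith : 0 ≤ Real.exp (dist x x₀) - 1),
      mul_nonneg hf.nonneg (by linarith : 0 ≤ Real.exp (dist x x₀) - dist x x₀)]
  calc f x * |Real.log (f x)|
      ≤ (Real.exp (A * dist x x₀) * f x₀) * ((|Real.log (f x₀)| + A) * Real.exp (dist x x₀)) :=
        mul_le_mul (hf.le x x₀) h1 (abs_nonneg _) (mul_pos (Real.exp_pos _) (hf.pos _)).le
    _ = _ := by ring

end ExpMoments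

lemma integral_mul_log_nonneg {X : Type*} [MeasurableSpace X] {m : Measure X} {f : X → ℝ}
    [IsProbabilityMeasure m] (hf : ∀ x, 0 < f x)
    (hi : Integrable f m)
    (hil : Integrable (fun x => f x * Real.log (f x)) m) (h1 : ∫ x, f x ∂m = 1) :
    0 ≤ ∫ x, f x * Real.log (f x) ∂m := by
  have h : ∫ x, (f x - 1) ∂m ≤ ∫ x, f x * Real.log (f x) ∂m := by
    refine integral_mono (hi.sub (integrable_const _)) hil fun x => ?_
    have h2 := mul_le_mul_of_nonneg_left (Real.one_sub_inv_le_log_of_pos (hf x)) (hf x).le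
    rwa [mul_sub, mul_one, mul_inv_cancel₀ (hf x).ne'] at h2
  rwa [integral_sub hi (integrable_const _), h1, integral_const, probReal_univ, one_smul,
    sub_self] at h

lemma integrable_exp_dist_gaussianReal (B : ℝ) :
    Integrable (fun x : ℝ => Real.exp (B * dist x 0)) γ₁ := by
  simpa [Real.dist_eq] using integrable_exp_mul_abs_gaussianReal B

lemma integrable_exp_dist_prod {X Y : Type*} [PseudoMetricSpace X] [MeasurableSpace X]
    [OpensMeasurableSpace X] [SecondCountableTopology X] [PseudoMetricSpace Y] [MeasurableSpace Y]
    [OpensMeasurableSpace Y] {m : Measure X} {n : Measure Y} [SFinite m] [SFinite n] {x₀ : X}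
    {y₀ : Y}
    (hm : ∀ B : ℝ, Integrable (fun x => Real.exp (B * dist x x₀)) m)
    (hn : ∀ B : ℝ, Integrable (fun y => Real.exp (B * dist y y₀)) n) (B : ℝ) :
    Integrable (fun z : X × Y => Real.exp (B * dist z (x₀, y₀))) (m.prod n) := by
  refine ((hm |B|).mul_prod (hn |B|)).mono' (by fun_prop) (ae_of_all _ fun z => ?_)
  rw [Real.norm_of_nonneg (Real.exp_pos _).le, ← Real.exp_add, Real.exp_le_exp, ← mul_add]
  refine mul_le_mul (le_abs_self B) ?_ dist_nonneg (abs_nonneg B)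
  rw [Prod.dist_eq]
  exact max_le_add_of_nonneg dist_nonneg dist_nonneg

/-- The marginal density on `E` of the density `f` on `ℝ × E`. -/
def marginalDensity {E : Type*} (f : ℝ × E → ℝ) (x : E) : ℝ := ∫ t, f (t, x) ∂γ₁

/-- The conditional density on `ℝ` given `x : E`. -/
def condDensity {E : Type*} (f : ℝ × E → ℝ) (x : E) (t : ℝ) : ℝ := f (t, x) / marginalDensity f x

lemma IsLogLipschitz.fibre {E : Type*} [PseudoMetricSpace E] {A : ℝ} {f : ℝ × E → ℝ}
    (hf : IsLogLipschitz A f) (x : E) : IsLogLipschitz A fun t => f (t, x) where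
  nonneg := hf.nonneg
  pos _ := hf.pos _
  le s t := by simpa [Prod.dist_eq] using hf.le (s, x) (t, x)

lemma IsLogLipschitz.marginalDensity_pos {E : Type*} [PseudoMetricSpace E] {A : ℝ} {f : ℝ × E → ℝ}
    (hf : IsLogLipschitz A f) (x : E) : 0 < marginalDensity f x := by
  rw [marginalDensity, integral_pos_iff_support_of_nonneg (fun t => (hf.pos _).le)
    (hf.fibre x).integrable_gaussianReal, Function.support_eq_univ fun t => (hf.pos _).ne']
  simp

section Tensorization

variable {E : Type*} [PseudoMetricSpace E] {A : ℝ} {f : ℝ × E → ℝ}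

namespace IsLogLipschitz

lemma marginal (hf : IsLogLipschitz A f) : IsLogLipschitz A (marginalDensity f) where
  nonneg := hf.nonneg
  pos := hf.marginalDensity_pos
  le x y := by
    rw [marginalDensity, marginalDensity, ← integral_const_mul]
    refine integral_mono (hf.fibre x).integrable_gaussianReal
      ((hf.fibre y).integrable_gaussianReal.const_mul _) fun t => ?_
    simpa [Prod.dist_eq] using hf.le (t, x) (t, y)

lemma cond (hf : IsLogLipschitz A f) (x : E) : IsGaussDensity A (condDensity f x) where
  nonneg := hf.nonneg
  pos _ := div_pos (hf.pos _) (hf.marginalDensity_pos x)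
  le s t := by
    rw [condDensity, condDensity, mul_div_assoc']
    exact div_le_div_of_nonneg_right ((hf.fibre x).le s t) (hf.marginalDensity_pos x).le
  integral_eq_one := by
    simp only [condDensity, integral_div]
    exact div_self (hf.marginalDensity_pos x).ne'

/-- The chain rule for the relative entropy, fibrewise. -/
lemma marginalDensity_mul_integral_cond (hf : IsLogLipschitz A f) (x : E) :
    marginalDensity f x * ∫ t, condDensity f x t * Real.log (condDensity f x t) ∂γ₁ =
      (∫ t, f (t, x) * Real.log (f (t, x)) ∂γ₁) -
        marginalDensity f x * Real.log (marginalDensity f x) := by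
  have hp := hf.marginalDensity_pos x
  have h : ∀ t, marginalDensity f x * (condDensity f x t * Real.log (condDensity f x t)) =
      f (t, x) * Real.log (f (t, x)) - f (t, x) * Real.log (marginalDensity f x) := fun t => by
    rw [condDensity, Real.log_div (hf.pos _).ne' hp.ne', ← mul_assoc, mul_div_cancel₀ _ hp.ne',
      mul_sub]
  rw [← integral_const_mul, integral_congr_ae (ae_of_all _ h), integral_sub
    ((hf.fibre x).integrable_mul_log integrable_exp_dist_gaussianReal)
    ((hf.fibre x).integrable_gaussianReal.mul_const _), integral_mul_const]
  rfl

end IsLogLipschitz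

variable [MeasurableSpace E] [OpensMeasurableSpace E] [SecondCountableTopology E] {m : Measure E}
  {x₀ : E}

namespace IsLogLipschitz

lemma measurable_gaussTransport (hf : IsLogLipschitz A f) :
    Measurable fun p : ℝ × E => gaussTransport (condDensity f p.2) p.1 := by
  refine measurable_of_Iic fun s => ?_
  have h : (fun p : ℝ × E => gaussTransport (condDensity f p.2) p.1) ⁻¹' Iic s =
      {p | gaussCDF (fun _ => 1) p.1 ≤ gaussCDF (condDensity f p.2) s} := by
    ext p
    exact (hf.cond p.2).gaussTransport_le_iff p.1 s
  rw [h]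
  have h1 : Measurable (gaussCDF fun _ => 1) := IsGaussDensity.one.strictMono.monotone.measurable
  have h2 : Measurable fun x => gaussCDF (condDensity f x) s := by
    have h3 : StronglyMeasurable fun p : E × ℝ => condDensity f p.1 p.2 := by
      refine Measurable.stronglyMeasurable ?_
      exact (hf.continuous.measurable.comp measurable_swap).div
        (hf.marginal.continuous.measurable.comp measurable_fst)
    exact (h3.integral_prod_right (ν := (γ₁).restrict (Iic s))).measurable
  exact measurableSet_le (h1.comp measurable_fst) (h2.comp measurable_snd)

/-- The fibrewise monotone transport pushes `N(0,1)` times the marginal of `f` to `f`. -/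
lemma map_fibre_transport [SFinite m] (hf : IsLogLipschitz A f) :
    ((γ₁).prod (m.withDensity fun x => ENNReal.ofReal (marginalDensity f x))).map
      (fun p => (gaussTransport (condDensity f p.2) p.1, p.2)) =
    ((γ₁).prod m).withDensity fun p => ENNReal.ofReal (f p) := by
  have hS := hf.measurable_gaussTransport
  have hfm := hf.continuous.measurable
  have hmm := hf.marginal.continuous.measurable
  refine Measure.ext_of_lintegral _ fun h hh => ?_
  rw [lintegral_map hh (by fun_prop), lintegral_prod_symm' _ (by fun_prop),
    lintegral_withDensity_eq_lintegral_mul _ (by fun_prop)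
      (Measurable.lintegral_prod_left' (f := fun p : ℝ × E =>
        h (gaussTransport (condDensity f p.2) p.1, p.2)) (by fun_prop)),
    lintegral_withDensity_eq_lintegral_mul _ (by fun_prop) hh, lintegral_prod_symm' _ (by fun_prop)]
  refine lintegral_congr fun x => ?_
  have hc := hf.cond x
  simp only [Pi.mul_apply]
  rw [← lintegral_map (f := fun t => h (t, x)) (by fun_prop)
      hc.continuous_gaussTransport.measurable,
    hc.map_gaussTransport, lintegral_withDensity_eq_lintegral_mul _
      hc.continuous.measurable.ennreal_ofReal (by fun_prop), ← lintegral_const_mul _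
      (by have := hc.continuous.measurable; fun_prop)]
  refine lintegral_congr fun t => ?_
  rw [Pi.mul_apply, ← mul_assoc, ← ENNReal.ofReal_mul (hf.marginalDensity_pos x).le, condDensity,
    mul_div_cancel₀ _ (hf.marginalDensity_pos x).ne']

/-- Tensorization of the transport-entropy inequality. -/
lemma exists_coupling_prod [IsProbabilityMeasure m] (hf : IsLogLipschitz A f)
    (hm : ∀ B : ℝ, Integrable (fun x => Real.exp (B * dist x x₀)) m)
    (h1 : ∫ p, f p ∂((γ₁).prod m) = 1) {c : E × E → ℝ≥0∞} (hc : Measurable c)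
    (τ : Measure (E × E)) [SFinite τ]
    (hτ₁ : τ.map Prod.fst = m.withDensity fun x => ENNReal.ofReal (marginalDensity f x))
    (hτ₂ : τ.map Prod.snd = m)
    (hτ : ∫⁻ z, c z ∂τ ≤
      ENNReal.ofReal (2 * ∫ x, marginalDensity f x * Real.log (marginalDensity f x) ∂m)) :
    ∃ τ' : Measure ((ℝ × E) × (ℝ × E)),
      τ'.map Prod.fst = ((γ₁).prod m).withDensity (fun p => ENNReal.ofReal (f p)) ∧
      τ'.map Prod.snd = (γ₁).prod m ∧
      ∫⁻ z, (ENNReal.ofReal ((z.1.1 - z.2.1) ^ 2) + c (z.1.2, z.2.2)) ∂τ' ≤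
        ENNReal.ofReal (2 * ∫ p, f p * Real.log (f p) ∂((γ₁).prod m)) := by
  have hS := hf.measurable_gaussTransport
  have hmm := hf.marginal.continuous.measurable
  have hm' := integrable_exp_dist_prod integrable_exp_dist_gaussianReal hm
  let T : ℝ × (E × E) → (ℝ × E) × (ℝ × E) := fun p =>
    ((gaussTransport (condDensity f p.2.1) p.1, p.2.1), (p.1, p.2.2))
  have hT1 : Measurable fun p : ℝ × (E × E) => gaussTransport (condDensity f p.2.1) p.1 :=
    hS.comp (measurable_fst.prodMk (measurable_fst.comp measurable_snd))
  have hT : Measurable T := by fun_prop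
  have hfst : ((γ₁).prod τ).map (fun p : ℝ × (E × E) => (p.1, p.2.1)) =
      (γ₁).prod (m.withDensity fun x => ENNReal.ofReal (marginalDensity f x)) := by
    rw [← hτ₁]
    have := Measure.map_prod_map γ₁ τ (f := id) (g := Prod.fst) measurable_id measurable_fst
    rw [Measure.map_id] at this
    exact this.symm
  have hsnd : ((γ₁).prod τ).map (fun p : ℝ × (E × E) => (p.1, p.2.2)) = (γ₁).prod m := by
    conv_rhs => rw [← hτ₂]
    have := Measure.map_prod_map γ₁ τ (f := id) (g := Prod.snd) measurable_id measurable_snd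
    rw [Measure.map_id] at this
    exact this.symm
  refine ⟨((γ₁).prod τ).map T, ?_, ?_, ?_⟩
  · rw [Measure.map_map measurable_fst hT, ← hf.map_fibre_transport, ← hfst,
      Measure.map_map (by fun_prop) (by fun_prop)]
    rfl
  · rw [Measure.map_map measurable_snd hT, ← hsnd]
    rfl
  rw [lintegral_map (by fun_prop) hT, lintegral_add_left (by fun_prop)]
  have hcost : ∫⁻ p, c ((T p).1.2, (T p).2.2) ∂((γ₁).prod τ) = ∫⁻ z, c z ∂τ := by
    rw [lintegral_prod _ (by fun_prop)]
    simp [T]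
  let H : E → ℝ := fun x => (∫ t, f (t, x) * Real.log (f (t, x)) ∂γ₁) -
    marginalDensity f x * Real.log (marginalDensity f x)
  have hH : ∀ x, marginalDensity f x * ∫ t, condDensity f x t * Real.log (condDensity f x t) ∂γ₁ =
    H x := hf.marginalDensity_mul_integral_cond
  have hH0 : ∀ x, 0 ≤ H x := fun x => by
    rw [← hH x]
    refine mul_nonneg (hf.marginalDensity_pos x).le ?_
    have := (hf.cond x).integral_gaussTransport_sub_sq_le
    have h0 : 0 ≤ ∫ t, (gaussTransport (condDensity f x) t - t) ^ 2 ∂γ₁ :=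
      integral_nonneg fun t => sq_nonneg _
    linarith
  have hI1 := hf.integrable_mul_log hm'
  have hI2 := hf.marginal.integrable_mul_log hm
  have hHi : Integrable H m := hI1.integral_prod_right.sub hI2
  have hcost2 : ∫⁻ p, ENNReal.ofReal (((T p).1.1 - (T p).2.1) ^ 2) ∂((γ₁).prod τ) ≤
      ENNReal.ofReal (2 * ∫ x, H x ∂m) := by
    have h2 : ∫⁻ p, ENNReal.ofReal (((T p).1.1 - (T p).2.1) ^ 2) ∂((γ₁).prod τ) =
        ∫⁻ q, ENNReal.ofReal ((gaussTransport (condDensity f q.2) q.1 - q.1) ^ 2)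
          ∂((γ₁).prod (m.withDensity fun x => ENNReal.ofReal (marginalDensity f x))) := by
      rw [← hfst, lintegral_map (by fun_prop) (by fun_prop)]
    rw [h2, lintegral_prod_symm' _ (by fun_prop), lintegral_withDensity_eq_lintegral_mul _
      (by fun_prop) (Measurable.lintegral_prod_left' (f := fun q : ℝ × E =>
        ENNReal.ofReal ((gaussTransport (condDensity f q.2) q.1 - q.1) ^ 2)) (by fun_prop)),
      ← integral_const_mul, ofReal_integral_eq_lintegral_ofReal (hHi.const_mul 2)
        (ae_of_all _ fun x => mul_nonneg zero_le_two (hH0 x))]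
    refine lintegral_mono fun x => ?_
    simp only [Pi.mul_apply]
    rw [← ofReal_integral_eq_lintegral_ofReal (hf.cond x).integrable_gaussTransport_sub_sq
      (ae_of_all _ fun t => sq_nonneg _), ← ENNReal.ofReal_mul (hf.marginalDensity_pos x).le,
      ← hH x]
    refine ENNReal.ofReal_le_ofReal ?_
    have := mul_le_mul_of_nonneg_left (hf.cond x).integral_gaussTransport_sub_sq_le
      (hf.marginalDensity_pos x).le
    linarith
  rw [hcost]
  have hmi1 : ∫ x, marginalDensity f x ∂m = 1 := by
    rw [← h1, integral_prod_symm _ (hf.integrable hm')]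
    rfl
  have hnn := integral_mul_log_nonneg hf.marginalDensity_pos (hf.marginal.integrable hm) hI2 hmi1
  refine (add_le_add hcost2 hτ).trans_eq ?_
  rw [← ENNReal.ofReal_add (mul_nonneg zero_le_two (integral_nonneg hH0))
    (mul_nonneg zero_le_two hnn), ← mul_add, integral_sub hI1.integral_prod_right hI2,
    integral_prod_symm _ hI1, sub_add_cancel]

end IsLogLipschitz

end Tensorization

/-- The standard Gaussian measure on `Fin n → ℝ`. -/
abbrev gaussPi (n : ℕ) : Measure (Fin n → ℝ) := Measure.pi fun _ => γ₁

lemma integrable_exp_dist_gaussPi (n : ℕ) (B : ℝ) :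
    Integrable (fun x : Fin n → ℝ => Real.exp (B * dist x 0)) (gaussPi n) := by
  have h : Integrable (fun x : Fin n → ℝ => ∏ i, Real.exp (|B| * |x i|)) (gaussPi n) :=
    Integrable.fintype_prod fun _ => integrable_exp_mul_abs_gaussianReal |B|
  refine h.mono' (by fun_prop) (ae_of_all _ fun x => ?_)
  rw [Real.norm_of_nonneg (Real.exp_pos _).le, ← Real.exp_sum, Real.exp_le_exp, ← Finset.mul_sum]
  refine mul_le_mul (le_abs_self B) ?_ dist_nonneg (abs_nonneg B)
  rw [dist_zero_right]
  refine (pi_norm_le_iff_of_nonneg (Finset.sum_nonneg fun i _ => abs_nonneg _)).2 fun i => ?_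
  exact Finset.single_le_sum (f := fun i => |x i|) (fun i _ => abs_nonneg _) (Finset.mem_univ i)

/-- A measure preserving equivalence transports densities. -/
lemma map_symm_withDensity {X Y : Type*} [MeasurableSpace X] [MeasurableSpace Y] {m : Measure X}
    {m' : Measure Y} {e : X ≃ᵐ Y} (he : MeasurePreserving e m m') {f : X → ℝ≥0∞}
    (hf : Measurable f) : (m'.withDensity (f ∘ e.symm)).map e.symm = m.withDensity f := by
  ext s hs
  rw [Measure.map_apply e.symm.measurable hs, withDensity_apply _ (e.symm.measurable hs),
    withDensity_apply _ hs]
  exact (he.symm).setLIntegral_comp_preimage hs hf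

/-- **Talagrand's transport-entropy inequality** for densities with Lipschitz logarithm. -/
theorem exists_coupling_gaussPi (n : ℕ) {A : ℝ} {f : (Fin n → ℝ) → ℝ} (hf : IsLogLipschitz A f)
    (h1 : ∫ x, f x ∂(gaussPi n) = 1) :
    ∃ τ : Measure ((Fin n → ℝ) × (Fin n → ℝ)),
      τ.map Prod.fst = (gaussPi n).withDensity (fun x => ENNReal.ofReal (f x)) ∧
      τ.map Prod.snd = gaussPi n ∧
      ∫⁻ z, ENNReal.ofReal (∑ i, (z.1 i - z.2 i) ^ 2) ∂τ ≤
        ENNReal.ofReal (2 * ∫ x, f x * Real.log (f x) ∂(gaussPi n)) := by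
  induction n with
  | zero =>
    have hf1 : ∀ x, f x = 1 := fun x => by
      rw [← h1, integral_congr_ae (ae_of_all _ fun y => congrArg f (Subsingleton.elim y x))]
      simp
    refine ⟨(gaussPi 0).map fun x => (x, x), ?_, ?_, by simp⟩
    · rw [Measure.map_map measurable_fst (by fun_prop)]
      simp only [hf1, ENNReal.ofReal_one, withDensity_const, one_smul]
      exact Measure.map_id
    · rw [Measure.map_map measurable_snd (by fun_prop)]
      exact Measure.map_id
  | succ n ih =>
    let e := MeasurableEquiv.piFinSuccAbove (fun _ : Fin (n + 1) => ℝ) 0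
    have he : MeasurePreserving e (gaussPi (n + 1)) ((γ₁).prod (gaussPi n)) :=
      measurePreserving_piFinSuccAbove (fun _ => γ₁) 0
    have hd : ∀ p q : ℝ × (Fin n → ℝ), dist (e.symm p) (e.symm q) ≤ dist p q := fun p q => by
      refine (dist_pi_le_iff dist_nonneg).2 fun i => ?_
      refine Fin.cases ?_ (fun j => ?_) i
      · exact le_max_left _ _
      · exact (dist_le_pi_dist p.2 q.2 j).trans (le_max_right _ _)
    have hfe : IsLogLipschitz A (f ∘ e.symm) :=
      { nonneg := hf.nonneg
        pos := fun _ => hf.pos _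
        le := fun p q => (hf.le _ _).trans (mul_le_mul_of_nonneg_right
          (Real.exp_le_exp.2 (mul_le_mul_of_nonneg_left (hd p q) hf.nonneg)) (hf.pos _).le) }
    have hm := integrable_exp_dist_gaussPi n
    have hint : ∀ g : (Fin (n + 1) → ℝ) → ℝ,
        ∫ p, g (e.symm p) ∂((γ₁).prod (gaussPi n)) = ∫ x, g x ∂(gaussPi (n + 1)) := fun g =>
      (he.symm).integral_comp' g
    have h1e : ∫ p, (f ∘ e.symm) p ∂((γ₁).prod (gaussPi n)) = 1 := (hint f).trans h1
    have hm1 : ∫ x, marginalDensity (f ∘ e.symm) x ∂(gaussPi n) = 1 := by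
      rw [← h1e, integral_prod_symm _ (hfe.integrable
        (integrable_exp_dist_prod integrable_exp_dist_gaussianReal hm))]
      rfl
    obtain ⟨τ, hτ₁, hτ₂, hτ⟩ := ih hfe.marginal hm1
    have : IsProbabilityMeasure τ := by
      have : IsProbabilityMeasure (τ.map Prod.snd) := hτ₂ ▸ inferInstance
      exact Measure.isProbabilityMeasure_of_map Prod.snd
    obtain ⟨τ', h₁, h₂, h⟩ := hfe.exists_coupling_prod hm h1e
      (c := fun z => ENNReal.ofReal (∑ i, (z.1 i - z.2 i) ^ 2)) (by fun_prop) τ hτ₁ hτ₂ hτ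
    refine ⟨τ'.map (Prod.map e.symm e.symm), ?_, ?_, ?_⟩
    · rw [Measure.map_map measurable_fst (by fun_prop),
        ← map_symm_withDensity he hf.continuous.measurable.ennreal_ofReal]
      refine Eq.trans ?_ (congrArg _ h₁)
      rw [Measure.map_map e.symm.measurable measurable_fst]
      rfl
    · rw [Measure.map_map measurable_snd (by fun_prop), ← he.symm.map_eq, ← h₂,
        Measure.map_map e.symm.measurable measurable_snd]
      rfl
    · rw [lintegral_map (by fun_prop) (by fun_prop), ← hint fun x => f x * Real.log (f x)]
      refine (lintegral_mono fun z => ?_).trans h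
      rw [← ENNReal.ofReal_add (sq_nonneg _) (Finset.sum_nonneg fun i _ => sq_nonneg _),
        Fin.sum_univ_succ]
      exact le_rfl

/-- The Cameron-Martin formula for `gaussPi`. -/
lemma gaussPi_map_const_add (n : ℕ) (a : Fin n → ℝ) :
    (gaussPi n).map (fun x => a + x) =
      (gaussPi n).withDensity fun x =>
        ENNReal.ofReal (∏ i, Real.exp (a i * x i - a i ^ 2 / 2)) := by
  have h : (gaussPi n).map (fun x => a + x) = Measure.pi fun i => (γ₁).map fun x => a i + x := by
    have := Measure.pi_map_pi (μ := fun _ : Fin n => γ₁) (f := fun i (x : ℝ) => a i + x)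
      (fun i => by fun_prop)
    exact this
  rw [h]
  refine Measure.pi_eq fun s hs => ?_
  have hi : ∀ i, Integrable ((s i).indicator fun x => Real.exp (a i * x - a i ^ 2 / 2)) γ₁ :=
    fun i => (IsGaussDensity.exp_tilt (a i)).integrable.indicator (hs i)
  have hprod : ∀ x : Fin n → ℝ,
      (univ.pi s).indicator (fun x => ENNReal.ofReal (∏ i, Real.exp (a i * x i - a i ^ 2 / 2))) x =
      ENNReal.ofReal (∏ i, (s i).indicator (fun x => Real.exp (a i * x - a i ^ 2 / 2)) (x i)) := by
    intro x
    by_cases hx : x ∈ univ.pi s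
    · rw [indicator_of_mem hx]
      congr 1
      exact Finset.prod_congr rfl fun i _ => (indicator_of_mem (hx i (mem_univ i))
        fun x => Real.exp (a i * x - a i ^ 2 / 2)).symm
    · rw [indicator_of_notMem hx]
      obtain ⟨i, hi⟩ : ∃ i, x i ∉ s i := by simpa using hx
      rw [Finset.prod_eq_zero (Finset.mem_univ i) (indicator_of_notMem hi _), ENNReal.ofReal_zero]
  have hnn : ∀ i x, 0 ≤ (s i).indicator (fun x => Real.exp (a i * x - a i ^ 2 / 2)) x := fun i x =>
    indicator_nonneg (fun _ _ => (Real.exp_pos _).le) x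
  rw [withDensity_apply _ (MeasurableSet.univ_pi hs),
    ← lintegral_indicator (MeasurableSet.univ_pi hs), lintegral_congr hprod,
    ← ofReal_integral_eq_lintegral_ofReal (Integrable.fintype_prod_dep hi)
      (ae_of_all _ fun x => Finset.prod_nonneg fun i _ => hnn i _),
    integral_fintype_prod_eq_prod, ENNReal.ofReal_prod_of_nonneg fun i _ =>
      integral_nonneg (hnn i)]
  refine Finset.prod_congr rfl fun i _ => ?_
  rw [gaussianReal_map_const_add_eq_withDensity, withDensity_apply _ (hs i),
    ← ofReal_integral_eq_lintegral_ofReal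
      (IsGaussDensity.exp_tilt (a i)).integrable.integrableOn
      (ae_of_all _ fun _ => (Real.exp_pos _).le), integral_indicator (hs i)]

lemma integrable_exp_sum_gaussPi (n : ℕ) (b : Fin n → ℝ) :
    Integrable (fun x => Real.exp (∑ i, b i * x i)) (gaussPi n) := by
  simp only [Real.exp_sum]
  exact Integrable.fintype_prod_dep fun i => integrable_exp_mul_gaussianReal (b i)

lemma integral_exp_sum_gaussPi (n : ℕ) (b : Fin n → ℝ) :
    ∫ x, Real.exp (∑ i, b i * x i) ∂(gaussPi n) = Real.exp (∑ i, b i ^ 2 / 2) := by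
  simp only [Real.exp_sum]
  rw [integral_fintype_prod_eq_prod (f := fun i t => Real.exp (b i * t))]
  refine Finset.prod_congr rfl fun i _ => ?_
  have h := congrFun (mgf_fun_id_gaussianReal (μ := 0) (v := 1)) (b i)
  simpa [mgf] using h

lemma abs_le_of_sum_sq_le {n : ℕ} {v : Fin n → ℝ} {R : ℝ} (hR : 0 ≤ R)
    (hv : ∑ i, v i ^ 2 ≤ R ^ 2) (i : Fin n) : |v i| ≤ R :=
  abs_le_of_sq_le_sq ((Finset.single_le_sum (f := fun i => v i ^ 2) (fun _ _ => sq_nonneg _)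
    (Finset.mem_univ i)).trans hv) hR

lemma abs_sum_mul_le_sq {Ω : Type*} {n : ℕ} {a : Ω → Fin n → ℝ} {R : ℝ}
    (hb : ∀ ω, ∑ i, a ω i ^ 2 ≤ R ^ 2) (ω ω' : Ω) :
    |∑ i, a ω i * a ω' i| ≤ R ^ 2 := by
  refine abs_le_of_sq_le_sq ?_ (sq_nonneg R)
  calc (∑ i, a ω i * a ω' i) ^ 2 ≤ (∑ i, a ω i ^ 2) * ∑ i, a ω' i ^ 2 :=
        Finset.sum_mul_sq_le_sq_mul_sq _ _ _
    _ ≤ R ^ 2 * R ^ 2 := mul_le_mul (hb ω) (hb ω')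
        (Finset.sum_nonneg fun i _ => sq_nonneg _) (sq_nonneg R)
    _ = _ := (sq _).symm

section Mixture

variable {Ω : Type*} [MeasurableSpace Ω] {n : ℕ}

/-- The Gaussian density of `N(a, I)` relative to `N(0, I)`. -/
def gaussShift (a y : Fin n → ℝ) : ℝ := Real.exp (∑ i, (a i * y i - a i ^ 2 / 2))

/-- The density of the law of `a + Z` relative to the law of the independent standard Gaussian
vector `Z`. -/
def gaussMixture (P : Measure Ω) (a : Ω → Fin n → ℝ) (y : Fin n → ℝ) : ℝ :=
  ∫ ω, gaussShift (a ω) y ∂P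

lemma gaussShift_pos (a y : Fin n → ℝ) : 0 < gaussShift a y := Real.exp_pos _

lemma gaussShift_le (a y : Fin n → ℝ) : gaussShift a y ≤ Real.exp (∑ i, y i ^ 2 / 2) :=
  Real.exp_le_exp.2 (Finset.sum_le_sum fun i _ => by nlinarith [sq_nonneg (a i - y i)])

lemma measurable_gaussShift {u v : Ω → Fin n → ℝ} (hu : Measurable u) (hv : Measurable v) :
    Measurable fun ω => gaussShift (u ω) (v ω) := by
  unfold gaussShift
  fun_prop

lemma gaussShift_eq (a y : Fin n → ℝ) :
    gaussShift a y = Real.exp (-∑ i, a i ^ 2 / 2) * Real.exp (∑ i, a i * y i) := by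
  rw [gaussShift, ← Real.exp_add, Finset.sum_sub_distrib]
  ring_nf

lemma gaussShift_mul (a b y : Fin n → ℝ) :
    gaussShift a y * gaussShift b y =
      Real.exp (-∑ i, (a i ^ 2 + b i ^ 2) / 2) * Real.exp (∑ i, (a i + b i) * y i) := by
  simp only [gaussShift, ← Real.exp_add, ← Finset.sum_add_distrib, ← Finset.sum_neg_distrib]
  exact congrArg _ (Finset.sum_congr rfl fun i _ => by ring)

lemma integrable_gaussShift (a : Fin n → ℝ) : Integrable (gaussShift a) (gaussPi n) :=
  ((integrable_exp_sum_gaussPi n a).const_mul _).congr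
    (ae_of_all _ fun y => (gaussShift_eq a y).symm)

lemma integral_gaussShift (a : Fin n → ℝ) : ∫ y, gaussShift a y ∂(gaussPi n) = 1 := by
  simp only [gaussShift_eq, integral_const_mul, integral_exp_sum_gaussPi]
  rw [← Real.exp_add, neg_add_cancel, Real.exp_zero]

lemma integrable_gaussShift_mul (a b : Fin n → ℝ) :
    Integrable (fun y => gaussShift a y * gaussShift b y) (gaussPi n) :=
  ((integrable_exp_sum_gaussPi n (fun i => a i + b i)).const_mul _).congr
    (ae_of_all _ fun y => (gaussShift_mul a b y).symm)

lemma integral_gaussShift_mul (a b : Fin n → ℝ) :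
    ∫ y, gaussShift a y * gaussShift b y ∂(gaussPi n) = Real.exp (∑ i, a i * b i) := by
  simp only [gaussShift_mul, integral_const_mul]
  rw [integral_exp_sum_gaussPi n fun i => a i + b i, ← Real.exp_add, ← Finset.sum_neg_distrib,
    ← Finset.sum_add_distrib]
  exact congrArg _ (Finset.sum_congr rfl fun i _ => by ring)

variable {P : Measure Ω} [IsProbabilityMeasure P] {a : Ω → Fin n → ℝ} {R : ℝ}

lemma integrable_gaussShift_left (ha : Measurable a) (y : Fin n → ℝ) :
    Integrable (fun ω => gaussShift (a ω) y) P :=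
  (integrable_const (Real.exp (∑ i, y i ^ 2 / 2))).mono'
    (measurable_gaussShift ha measurable_const).aestronglyMeasurable (ae_of_all _ fun ω => by
      rw [Real.norm_of_nonneg (gaussShift_pos _ _).le]
      exact gaussShift_le _ _)

lemma isLogLipschitz_gaussMixture (ha : Measurable a) (hR : 0 ≤ R) (hb : ∀ ω i, |a ω i| ≤ R) :
    IsLogLipschitz (n * R) (gaussMixture P a) where
  nonneg := by positivity
  pos _ := integral_exp_pos (integrable_gaussShift_left ha _)
  le x y := by
    rw [gaussMixture, gaussMixture, ← integral_const_mul]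
    refine integral_mono (integrable_gaussShift_left ha x)
      ((integrable_gaussShift_left ha y).const_mul _) fun ω => ?_
    simp only [gaussShift]
    rw [← Real.exp_add, Real.exp_le_exp, ← sub_le_iff_le_add, ← Finset.sum_sub_distrib]
    calc ∑ i, (a ω i * x i - a ω i ^ 2 / 2 - (a ω i * y i - a ω i ^ 2 / 2))
        ≤ ∑ _i : Fin n, R * dist x y := Finset.sum_le_sum fun i _ => by
          calc _ = a ω i * (x i - y i) := by ring
            _ ≤ |a ω i| * |x i - y i| := (le_abs_self _).trans (abs_mul _ _).le
            _ ≤ R * dist x y := mul_le_mul (hb ω i) (dist_le_pi_dist x y i) (abs_nonneg _) hR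
      _ = _ := by simp [mul_assoc]

lemma integrable_gaussShift_prod (ha : Measurable a) :
    Integrable (fun p : Ω × (Fin n → ℝ) => gaussShift (a p.1) p.2) (P.prod (gaussPi n)) := by
  have hm : Measurable fun p : Ω × (Fin n → ℝ) => gaussShift (a p.1) p.2 :=
    measurable_gaussShift (ha.comp measurable_fst) measurable_snd
  refine (integrable_prod_iff hm.aestronglyMeasurable).2
    ⟨ae_of_all _ fun ω => integrable_gaussShift (a ω), ?_⟩
  simp only [Real.norm_of_nonneg (gaussShift_pos _ _).le, integral_gaussShift]
  exact integrable_const _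

lemma integral_gaussMixture (ha : Measurable a) : ∫ y, gaussMixture P a y ∂(gaussPi n) = 1 := by
  have h := integral_integral_swap (f := fun ω y => gaussShift (a ω) y)
    (integrable_gaussShift_prod (P := P) ha)
  simp only [gaussMixture]
  rw [← h]
  simp [integral_gaussShift]

/-- The law of `a + Z` has density `gaussMixture P a`. -/
lemma map_add_eq_withDensity_gaussMixture (ha : Measurable a) :
    (P.prod (gaussPi n)).map (fun z => a z.1 + z.2) =
      (gaussPi n).withDensity fun y => ENNReal.ofReal (gaussMixture P a y) := by
  ext s hs
  have hm : Measurable fun z : Ω × (Fin n → ℝ) => a z.1 + z.2 :=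
    (ha.comp measurable_fst).add measurable_snd
  have h : ∀ ω, gaussPi n (Prod.mk ω ⁻¹' ((fun z : Ω × (Fin n → ℝ) => a z.1 + z.2) ⁻¹' s)) =
      ∫⁻ y in s, ENNReal.ofReal (gaussShift (a ω) y) ∂(gaussPi n) := fun ω => by
    have h1 := congrArg (fun m => m s) (gaussPi_map_const_add n (a ω))
    simp only [← Real.exp_sum] at h1
    rw [withDensity_apply _ hs, Measure.map_apply (by fun_prop) hs] at h1
    exact h1
  have hmeas := measurable_gaussShift (ha.comp measurable_fst) (measurable_snd (β := Fin n → ℝ))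
  rw [Measure.map_apply hm hs, Measure.prod_apply (hm hs), withDensity_apply _ hs,
    lintegral_congr h, lintegral_lintegral_swap hmeas.ennreal_ofReal.aemeasurable]
  refine lintegral_congr fun y => ?_
  rw [gaussMixture, ofReal_integral_eq_lintegral_ofReal (integrable_gaussShift_left ha y)
    (ae_of_all _ fun ω => (gaussShift_pos _ _).le)]

lemma measurable_sum_mul (ha : Measurable a) :
    Measurable fun q : Ω × Ω => ∑ i, a q.1 i * a q.2 i := by fun_prop

lemma integrable_gaussShift_mul_prod (ha : Measurable a) (hb : ∀ ω, ∑ i, a ω i ^ 2 ≤ R ^ 2) :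
    Integrable (fun p : (Ω × Ω) × (Fin n → ℝ) =>
      gaussShift (a p.1.1) p.2 * gaussShift (a p.1.2) p.2) ((P.prod P).prod (gaussPi n)) := by
  have hm : Measurable fun p : (Ω × Ω) × (Fin n → ℝ) =>
      gaussShift (a p.1.1) p.2 * gaussShift (a p.1.2) p.2 :=
    (measurable_gaussShift (ha.comp (measurable_fst.comp measurable_fst)) measurable_snd).mul
      (measurable_gaussShift (ha.comp (measurable_snd.comp measurable_fst)) measurable_snd)
  have h1 : ∀ q : Ω × Ω, Integrable (fun y => gaussShift (a q.1) y * gaussShift (a q.2) y)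
      (gaussPi n) := fun q => integrable_gaussShift_mul (a q.1) (a q.2)
  rw [integrable_prod_iff hm.aestronglyMeasurable]
  refine ⟨ae_of_all _ h1, ?_⟩
  simp only [Real.norm_of_nonneg (mul_pos (gaussShift_pos _ _) (gaussShift_pos _ _)).le,
    integral_gaussShift_mul]
  refine (integrable_const (Real.exp (R ^ 2))).mono'
    (measurable_sum_mul ha).exp.aestronglyMeasurable (ae_of_all _ fun q => ?_)
  rw [Real.norm_of_nonneg (Real.exp_pos _).le, Real.exp_le_exp]
  exact (le_abs_self _).trans (abs_sum_mul_le_sq hb _ _)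

lemma gaussMixture_sq (y : Fin n → ℝ) : gaussMixture P a y ^ 2 =
    ∫ q, gaussShift (a q.1) y * gaussShift (a q.2) y ∂(P.prod P) := by
  rw [sq, gaussMixture, ← integral_prod_mul]

lemma integrable_gaussMixture_sq (ha : Measurable a) (hb : ∀ ω, ∑ i, a ω i ^ 2 ≤ R ^ 2) :
    Integrable (fun y => gaussMixture P a y ^ 2) (gaussPi n) := by
  simp only [gaussMixture_sq]
  exact (integrable_gaussShift_mul_prod ha hb).integral_prod_right

lemma integral_gaussMixture_sq (ha : Measurable a) (hb : ∀ ω, ∑ i, a ω i ^ 2 ≤ R ^ 2) :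
    ∫ y, gaussMixture P a y ^ 2 ∂(gaussPi n) =
      ∫ q, Real.exp (∑ i, a q.1 i * a q.2 i) ∂(P.prod P) := by
  simp only [gaussMixture_sq, ← integral_gaussShift_mul]
  exact (integral_integral_swap
    (f := fun (q : Ω × Ω) y => gaussShift (a q.1) y * gaussShift (a q.2) y)
    (integrable_gaussShift_mul_prod (P := P) ha hb)).symm

end Mixture

/-- The Kullback-Leibler divergence is at most the Rényi divergence of order two. -/
lemma integral_mul_log_le_log_integral_sq {X : Type*} [MeasurableSpace X] {m : Measure X}
    {f : X → ℝ} (hf : ∀ x, 0 < f x) (hi : Integrable f m)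
    (hil : Integrable (fun x => f x * Real.log (f x)) m) (hsq : Integrable (fun x => f x ^ 2) m)
    (h1 : ∫ x, f x ∂m = 1) :
    ∫ x, f x * Real.log (f x) ∂m ≤ Real.log (∫ x, f x ^ 2 ∂m) := by
  set M := ∫ x, f x ^ 2 ∂m with hM
  have hMpos : 0 < M := by
    refine (integral_pos_iff_support_of_nonneg (fun x => sq_nonneg (f x)) hsq).2 ?_
    have : (Function.support fun x => f x ^ 2) = univ :=
      eq_univ_of_forall fun x => (pow_pos (hf x) 2).ne'
    rw [this, pos_iff_ne_zero, Measure.measure_univ_ne_zero]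
    rintro rfl
    simp at h1
  have hpt : ∀ x, f x * Real.log (f x) ≤ (Real.log M - 1) * f x + M⁻¹ * f x ^ 2 := fun x => by
    have h := Real.log_le_sub_one_of_pos (mul_pos (inv_pos.2 hMpos) (hf x))
    rw [Real.log_mul (inv_pos.2 hMpos).ne' (hf x).ne', Real.log_inv] at h
    nlinarith [hf x]
  calc ∫ x, f x * Real.log (f x) ∂m
      ≤ ∫ x, ((Real.log M - 1) * f x + M⁻¹ * f x ^ 2) ∂m :=
        integral_mono hil ((hi.const_mul _).add (hsq.const_mul _)) hpt
    _ = Real.log M := by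
        rw [integral_add (hi.const_mul _) (hsq.const_mul _), integral_const_mul, integral_const_mul,
          h1, ← hM, inv_mul_cancel₀ hMpos.ne']
        ring

/-- On `[-4, 4]` the exponential is dominated by the quadratic touching it at `0` and meeting it
at `4`. -/
lemma exp_le_one_add_add_cFour_mul_sq {t : ℝ} (ht : |t| ≤ 4) :
    Real.exp t ≤ 1 + t + cFour * t ^ 2 := by
  have hs : ∀ x : ℝ, HasSum (fun k : ℕ => x ^ (k + 2) / (k + 2).factorial)
      (Real.exp x - (1 + x)) := fun x => by
    have h := (hasSum_nat_add_iff' (f := fun k : ℕ => x ^ k / k.factorial) 2).2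
      (Real.exp_eq_exp_ℝ ▸ NormedSpace.expSeries_div_hasSum_exp x)
    simpa [Finset.sum_range_succ] using h
  have h4 := (hs 4).mul_left (t ^ 2 / 16)
  have h := hasSum_le (fun k => ?_) (hs t) h4
  · rw [cFour]
    linarith
  · rw [← mul_div_assoc]
    refine div_le_div_of_nonneg_right ?_ (by positivity)
    calc t ^ (k + 2) = t ^ k * t ^ 2 := pow_add _ _ _
      _ ≤ 4 ^ k * t ^ 2 := by
        refine mul_le_mul_of_nonneg_right ?_ (sq_nonneg t)
        exact (le_abs_self _).trans ((abs_pow t k).le.trans (pow_le_pow_left₀ (abs_nonneg t) ht k))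
      _ = t ^ 2 / 16 * 4 ^ (k + 2) := by ring

lemma cFour_nonneg : 0 ≤ cFour := by
  have h := Real.add_one_le_exp 4
  rw [cFour]
  linarith

/-- Second moment bound for the density of a centred Gaussian mixture. -/
lemma integral_gaussMixture_sq_le {Ω : Type*} [MeasurableSpace Ω] {P : Measure Ω}
    [IsProbabilityMeasure P] {n : ℕ} {a : Ω → Fin n → ℝ} (ha : Measurable a)
    (hb : ∀ ω, ∑ i, a ω i ^ 2 ≤ 2 ^ 2) (h0 : ∀ i, ∫ ω, a ω i ∂P = 0) :
    ∫ y, gaussMixture P a y ^ 2 ∂(gaussPi n) ≤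
      1 + cFour * ∑ i, ∑ j, (∫ ω, a ω i * a ω j ∂P) ^ 2 := by
  have hab := fun ω => abs_le_of_sum_sq_le zero_le_two (hb ω)
  have hai : ∀ i, Measurable fun ω => a ω i := fun i => (measurable_pi_apply i).comp ha
  have hi : ∀ i, Integrable (fun ω => a ω i) P := fun i =>
    (integrable_const (2 : ℝ)).mono' (hai i).aestronglyMeasurable (ae_of_all _ fun ω => hab ω i)
  have hi2 : ∀ i j, Integrable (fun ω => a ω i * a ω j) P := fun i j =>
    (hi j).bdd_mul (hai i).aestronglyMeasurable (ae_of_all _ fun ω => hab ω i)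
  have hS : Integrable (fun q : Ω × Ω => ∑ i, a q.1 i * a q.2 i) (P.prod P) :=
    integrable_finsetSum _ fun i _ => (hi i).mul_prod (hi i)
  have hsq : ∀ q : Ω × Ω, (∑ i, a q.1 i * a q.2 i) ^ 2 =
      ∑ i, ∑ j, (a q.1 i * a q.1 j) * (a q.2 i * a q.2 j) := fun q => by
    rw [sq, Finset.sum_mul_sum]
    exact Finset.sum_congr rfl fun i _ => Finset.sum_congr rfl fun j _ => by ring
  have hS2 : Integrable (fun q : Ω × Ω => (∑ i, a q.1 i * a q.2 i) ^ 2) (P.prod P) := by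
    simp only [hsq]
    exact integrable_finsetSum _ fun i _ => integrable_finsetSum _ fun j _ =>
      (hi2 i j).mul_prod (hi2 i j)
  have hSint : ∫ q, ∑ i, a q.1 i * a q.2 i ∂(P.prod P) = 0 := by
    rw [integral_finsetSum _ fun i _ => (hi i).mul_prod (hi i)]
    refine Finset.sum_eq_zero fun i _ => ?_
    rw [integral_prod_mul (fun ω => a ω i) fun ω => a ω i, h0, zero_mul]
  have hS2int : ∫ q, (∑ i, a q.1 i * a q.2 i) ^ 2 ∂(P.prod P) =
      ∑ i, ∑ j, (∫ ω, a ω i * a ω j ∂P) ^ 2 := by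
    simp only [hsq]
    rw [integral_finsetSum _ fun i _ => integrable_finsetSum _ fun j _ =>
      (hi2 i j).mul_prod (hi2 i j)]
    refine Finset.sum_congr rfl fun i _ => ?_
    rw [integral_finsetSum _ fun j _ => (hi2 i j).mul_prod (hi2 i j)]
    refine Finset.sum_congr rfl fun j _ => ?_
    rw [integral_prod_mul (fun ω => a ω i * a ω j) fun ω => a ω i * a ω j, sq]
  rw [integral_gaussMixture_sq ha hb]
  have habs : ∀ q : Ω × Ω, |∑ i, a q.1 i * a q.2 i| ≤ 4 := fun q =>
    (abs_sum_mul_le_sq hb q.1 q.2).trans (by norm_num)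
  calc ∫ q, Real.exp (∑ i, a q.1 i * a q.2 i) ∂(P.prod P)
      ≤ ∫ q, (1 + ∑ i, a q.1 i * a q.2 i + cFour * (∑ i, a q.1 i * a q.2 i) ^ 2) ∂(P.prod P) := by
        refine integral_mono ((integrable_const (Real.exp 4)).mono'
          (measurable_sum_mul ha).exp.aestronglyMeasurable (ae_of_all _ fun q => ?_))
          (((integrable_const 1).add hS).add (hS2.const_mul _))
          fun q => exp_le_one_add_add_cFour_mul_sq (habs q)
        rw [Real.norm_of_nonneg (Real.exp_pos _).le, Real.exp_le_exp]
        exact (le_abs_self _).trans (habs q)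
    _ = _ := by
        rw [integral_add (f := fun q : Ω × Ω => 1 + ∑ i, a q.1 i * a q.2 i)
          ((integrable_const 1).add hS) (hS2.const_mul _),
          integral_add (integrable_const 1) hS, integral_const_mul, hSint, hS2int]
        simp

/-- A bounded centred mixture of standard Gaussians is close to the standard Gaussian in
transport cost. -/
lemma exists_coupling_gaussMixture {Ω : Type*} [MeasurableSpace Ω] {P : Measure Ω}
    [IsProbabilityMeasure P] {n : ℕ} {a : Ω → Fin n → ℝ} (ha : Measurable a)
    (hb : ∀ ω, ∑ i, a ω i ^ 2 ≤ 2 ^ 2) (h0 : ∀ i, ∫ ω, a ω i ∂P = 0) :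
    ∃ τ : Measure ((Fin n → ℝ) × (Fin n → ℝ)),
      τ.map Prod.fst = (P.prod (gaussPi n)).map (fun z => a z.1 + z.2) ∧
      τ.map Prod.snd = gaussPi n ∧
      ∫⁻ z, ENNReal.ofReal (∑ i, (z.1 i - z.2 i) ^ 2) ∂τ ≤
        ENNReal.ofReal (2 * Real.log (1 + cFour * ∑ i, ∑ j, (∫ ω, a ω i * a ω j ∂P) ^ 2)) := by
  have hab := fun ω => abs_le_of_sum_sq_le zero_le_two (hb ω)
  have hl := isLogLipschitz_gaussMixture (P := P) ha (by norm_num) hab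
  have h1 := integral_gaussMixture (P := P) ha
  have hsq := integrable_gaussMixture_sq (P := P) ha hb
  have hm := integrable_exp_dist_gaussPi n
  obtain ⟨τ, h₁, h₂, h⟩ := exists_coupling_gaussPi n hl h1
  refine ⟨τ, h₁.trans (map_add_eq_withDensity_gaussMixture ha).symm, h₂,
    h.trans (ENNReal.ofReal_le_ofReal (mul_le_mul_of_nonneg_left ?_ zero_le_two))⟩
  have hkl := integral_mul_log_le_log_integral_sq hl.pos (hl.integrable hm)
    (hl.integrable_mul_log hm) hsq h1
  refine hkl.trans (Real.log_le_log ?_ (integral_gaussMixture_sq_le ha hb h0))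
  refine (integral_pos_iff_support_of_nonneg (fun x => sq_nonneg _) hsq).2 ?_
  have : (Function.support fun x => gaussMixture P a x ^ 2) = univ :=
    eq_univ_of_forall fun x => (pow_pos (hl.pos x) 2).ne'
  simp [this]

section Gluing

/-- The gluing lemma, for a coupling of `m.map g` with a second measure. -/
lemma exists_glued_measure {S E F : Type*} [MeasurableSpace S] [MeasurableSpace E]
    [MeasurableSpace F] [StandardBorelSpace F] [Nonempty F] {m : Measure S} [IsProbabilityMeasure m]
    {g : S → E} (hg : Measurable g) {τ : Measure (E × F)} (hτ : τ.map Prod.fst = m.map g) :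
    ∃ ρ : Measure (S × F), IsProbabilityMeasure ρ ∧ ρ.map Prod.fst = m ∧
      ρ.map (Prod.map g id) = τ := by
  have : IsProbabilityMeasure τ := by
    have : IsProbabilityMeasure (τ.map Prod.fst) :=
      hτ ▸ Measure.isProbabilityMeasure_map hg.aemeasurable
    exact Measure.isProbabilityMeasure_of_map Prod.fst
  refine ⟨m ⊗ₘ τ.condKernel.comap g hg, inferInstance, Measure.fst_compProd _ _, ?_⟩
  ext s hs
  have hm : Measurable (Prod.map g (id : F → F)) := hg.prodMap measurable_id
  have h := congrArg (fun m => m s) (τ.disintegrate τ.condKernel)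
  simp only [Measure.compProd_apply hs, Measure.fst, hτ,
    lintegral_map (Kernel.measurable_kernel_prodMk_left hs) hg] at h
  rw [Measure.map_apply hm hs, Measure.compProd_apply (hm hs), ← h]
  rfl

/-- Jointly distributed random vectors bound the Wasserstein distance of their laws. -/
lemma Wp_map_le_eLpNorm {W E : Type*} [MeasurableSpace W] [NormedAddCommGroup E]
    [MeasurableSpace E] [BorelSpace E] [SecondCountableTopology E] {ρ : Measure W} {u v : W → E}
    (hu : Measurable u) (hv : Measurable v) {p : ℝ} (hp : 0 < p) :
    Wp p (ρ.map u) (ρ.map v) ≤ eLpNorm (fun w => u w - v w) (ENNReal.ofReal p) ρ := by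
  have hm := hu.prodMk hv
  rw [eLpNorm_eq_lintegral_rpow_enorm_toReal (by simpa using hp) ENNReal.ofReal_ne_top,
    ENNReal.toReal_ofReal hp.le, Wp]
  refine ENNReal.rpow_le_rpow (iInf₂_le_of_le (ρ.map fun w => (u w, v w)) ⟨?_, ?_⟩ ?_)
    (by positivity)
  · rw [Measure.map_map measurable_fst hm]
    rfl
  · rw [Measure.map_map measurable_snd hm]
    rfl
  · rw [lintegral_map (by fun_prop) hm]
    refine lintegral_mono fun w => ?_
    rw [← ofReal_norm, ENNReal.ofReal_rpow_of_nonneg (norm_nonneg _) hp.le]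

end Gluing

section Truncation

variable {d : ℕ} (μ : Measure (EuclideanSpace ℝ (Fin d)))

instance : IsProbabilityMeasure (stdGaussian d) :=
  Measure.isProbabilityMeasure_map (by fun_prop)

/-- The part of `x` removed by the truncation. -/
def tailPart (x : EuclideanSpace ℝ (Fin d)) : EuclideanSpace ℝ (Fin d) :=
  {y : EuclideanSpace ℝ (Fin d) | 1 < ‖y‖}.indicator id x

lemma measurableSet_one_lt_norm : MeasurableSet {x : EuclideanSpace ℝ (Fin d) | 1 < ‖x‖} :=
  measurableSet_lt measurable_const measurable_norm

lemma measurableSet_norm_le_one : MeasurableSet {x : EuclideanSpace ℝ (Fin d) | ‖x‖ ≤ 1} :=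
  measurableSet_le measurable_norm measurable_const

lemma measurable_tailPart : Measurable (tailPart (d := d)) :=
  measurable_id.indicator measurableSet_one_lt_norm

lemma measurable_truncCentred : Measurable (truncCentred μ) :=
  (Measurable.ite measurableSet_norm_le_one measurable_id measurable_const).sub measurable_const

lemma tailPart_add_truncMean_add_truncCentred (x : EuclideanSpace ℝ (Fin d)) :
    tailPart x + truncMean μ + truncCentred μ x = x := by
  by_cases hx : ‖x‖ ≤ 1
  · simp [tailPart, truncCentred, hx]
  · simp [tailPart, truncCentred, hx, not_le.1 hx]

lemma tailOne_nonneg : 0 ≤ tailOne μ := integral_nonneg fun _ => norm_nonneg _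

variable {μ}

lemma integrable_norm_of_sq [IsProbabilityMeasure μ] (hmom : Integrable (fun x => ‖x‖ ^ 2) μ) :
    Integrable (fun x => x) μ :=
  ((memLp_two_iff_integrable_sq_norm aestronglyMeasurable_id).2 hmom).integrable one_le_two

lemma eLpNorm_one_tailPart (hi : Integrable (fun x => x) μ) :
    eLpNorm tailPart 1 μ = ENNReal.ofReal (tailOne μ) := by
  rw [show (tailPart : EuclideanSpace ℝ (Fin d) → _) = indicator _ id from rfl,
    eLpNorm_indicator_eq_eLpNorm_restrict measurableSet_one_lt_norm, eLpNorm_one_eq_lintegral_enorm,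
    tailOne, ofReal_integral_norm_eq_lintegral_enorm hi.integrableOn]
  rfl

lemma eLpNorm_two_tailPart (hmom : Integrable (fun x => ‖x‖ ^ 2) μ) :
    eLpNorm tailPart 2 μ = ENNReal.ofReal (tailTwo μ) := by
  rw [show (tailPart : EuclideanSpace ℝ (Fin d) → _) = indicator _ id from rfl,
    eLpNorm_indicator_eq_eLpNorm_restrict measurableSet_one_lt_norm,
    MemLp.eLpNorm_eq_integral_rpow_norm two_ne_zero ENNReal.ofNat_ne_top
      ((memLp_two_iff_integrable_sq_norm aestronglyMeasurable_id).2 hmom.integrableOn),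
    tailTwo, Real.sqrt_eq_rpow]
  norm_num

lemma norm_truncMean_le_tailOne (hmean : ∫ x, x ∂μ = 0) (hi : Integrable (fun x => x) μ) :
    ‖truncMean μ‖ ≤ tailOne μ := by
  have h := integral_add_compl measurableSet_norm_le_one hi
  have hc : {x : EuclideanSpace ℝ (Fin d) | ‖x‖ ≤ 1}ᶜ = {x | 1 < ‖x‖} := by
    ext x
    simp
  rw [hmean, hc] at h
  rw [truncMean, eq_neg_of_add_eq_zero_left h, norm_neg]
  exact norm_integral_le_integral_norm _

variable [IsProbabilityMeasure μ]

lemma tailOne_le_tailTwo (hmom : Integrable (fun x => ‖x‖ ^ 2) μ) : tailOne μ ≤ tailTwo μ := by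
  have h2 : 0 ≤ tailTwo μ := Real.sqrt_nonneg _
  rw [← ENNReal.ofReal_le_ofReal_iff h2,
    ← eLpNorm_one_tailPart (integrable_norm_of_sq hmom), ← eLpNorm_two_tailPart hmom]
  exact eLpNorm_le_eLpNorm_of_exponent_le one_le_two measurable_tailPart.aestronglyMeasurable

lemma norm_truncMean_le_one : ‖truncMean μ‖ ≤ 1 := by
  refine (norm_setIntegral_le_of_norm_le_const (measure_lt_top _ _) (C := 1)
    fun x hx => hx).trans ?_
  rw [one_mul]
  exact measureReal_le_one

lemma norm_truncCentred_le (x : EuclideanSpace ℝ (Fin d)) : ‖truncCentred μ x‖ ≤ 2 := by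
  have h : ‖if ‖x‖ ≤ 1 then x else 0‖ ≤ 1 := by
    split_ifs with hx
    · exact hx
    · simp
  exact (norm_sub_le _ _).trans (by linarith [norm_truncMean_le_one (μ := μ)])

lemma integrable_truncCentred : Integrable (truncCentred μ) μ :=
  (integrable_const (2 : ℝ)).mono' (measurable_truncCentred μ).aestronglyMeasurable
    (ae_of_all _ norm_truncCentred_le)

lemma integral_truncCentred (hi : Integrable (fun x => x) μ) : ∫ x, truncCentred μ x ∂μ = 0 := by
  have h : ∀ x : EuclideanSpace ℝ (Fin d), (if ‖x‖ ≤ 1 then x else 0) =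
      {x : EuclideanSpace ℝ (Fin d) | ‖x‖ ≤ 1}.indicator (fun x => x) x := fun x => rfl
  simp only [truncCentred, h]
  rw [integral_sub (hi.indicator measurableSet_norm_le_one) (integrable_const _),
    integral_indicator measurableSet_norm_le_one]
  simp [truncMean]

lemma integral_truncCentred_apply (hi : Integrable (fun x => x) μ) (i : Fin d) :
    ∫ x, truncCentred μ x i ∂μ = 0 := by
  have h := (EuclideanSpace.proj (𝕜 := ℝ) i).integral_comp_comm (integrable_truncCentred (μ := μ))
  rw [integral_truncCentred hi] at h
  simpa using h

/-- The truncated part of the convolution is close to the standard Gaussian. -/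
lemma exists_coupling_truncCentred (hi : Integrable (fun x => x) μ) :
    ∃ τ : Measure (EuclideanSpace ℝ (Fin d) × EuclideanSpace ℝ (Fin d)),
      τ.map Prod.fst = (μ.prod (stdGaussian d)).map (fun z => truncCentred μ z.1 + z.2) ∧
      τ.map Prod.snd = stdGaussian d ∧
      eLpNorm (fun z => z.1 - z.2) 2 τ ≤
        ENNReal.ofReal (Real.sqrt (2 * Real.log (1 + cFour * frob (truncCov μ) ^ 2))) := by
  let e : (Fin d → ℝ) → EuclideanSpace ℝ (Fin d) := WithLp.toLp 2
  have he : Measurable e := WithLp.measurable_toLp 2 _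
  have hT := measurable_truncCentred μ
  have hm : Measurable fun (x : EuclideanSpace ℝ (Fin d)) i => truncCentred μ x i :=
    (WithLp.measurable_ofLp 2 _).comp hT
  obtain ⟨τ, h₁, h₂, h⟩ := exists_coupling_gaussMixture (P := μ) hm (fun x => by
    rw [← EuclideanSpace.real_norm_sq_eq]
    exact pow_le_pow_left₀ (norm_nonneg _) (norm_truncCentred_le x) 2)
    (integral_truncCentred_apply hi)
  have hstd : stdGaussian d = (gaussPi d).map e := rfl
  refine ⟨τ.map (Prod.map e e), ?_, ?_, ?_⟩
  · have h3 : μ.prod (stdGaussian d) = (μ.prod (gaussPi d)).map (Prod.map id e) := by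
      rw [hstd, ← Measure.map_prod_map _ _ measurable_id he, Measure.map_id]
    rw [h3, Measure.map_map measurable_fst (by fun_prop),
      Measure.map_map (by fun_prop) (by fun_prop)]
    have h4 := congrArg (Measure.map e) h₁
    rw [Measure.map_map he measurable_fst, Measure.map_map he (by fun_prop)] at h4
    exact h4
  · have h4 := congrArg (Measure.map e) h₂
    rw [Measure.map_map he measurable_snd] at h4
    rw [Measure.map_map measurable_snd (by fun_prop)]
    exact h4
  · have hfrob : frob (truncCov μ) ^ 2 =
        ∑ i, ∑ j, (∫ x, truncCentred μ x i * truncCentred μ x j ∂μ) ^ 2 :=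
      Real.sq_sqrt (Finset.sum_nonneg fun i _ => Finset.sum_nonneg fun j _ => sq_nonneg _)
    have hz : ∀ z : (Fin d → ℝ) × (Fin d → ℝ), ‖e z.1 - e z.2‖ₑ ^ (2 : ℝ) =
        ENNReal.ofReal (∑ i, (z.1 i - z.2 i) ^ 2) := fun z => by
      rw [← ofReal_norm, ENNReal.ofReal_rpow_of_nonneg (norm_nonneg _) zero_le_two,
        Real.rpow_two, EuclideanSpace.real_norm_sq_eq]
      rfl
    rw [eLpNorm_map_measure (by fun_prop) (by fun_prop),
      eLpNorm_eq_lintegral_rpow_enorm_toReal two_ne_zero ENNReal.ofNat_ne_top, hfrob,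
      Real.sqrt_eq_rpow, ← ENNReal.ofReal_rpow_of_nonneg _ (by norm_num)]
    · refine ENNReal.rpow_le_rpow (le_trans (le_of_eq ?_) h) (by positivity)
      exact lintegral_congr hz
    · have := cFour_nonneg
      exact mul_nonneg zero_le_two (Real.log_nonneg (le_add_of_nonneg_right (by positivity)))

/-- The transport bound in which the truncation error is measured by an arbitrary `L^p` norm,
`1 ≤ p ≤ 2`. -/
lemma Wp_conv_stdGaussian_le (hi : Integrable (fun x => x) μ) {p : ℝ} (hp : 1 ≤ p) (hp2 : p ≤ 2) :
    Wp p (μ ∗ stdGaussian d) (stdGaussian d) ≤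
      eLpNorm tailPart (ENNReal.ofReal p) μ + ENNReal.ofReal ‖truncMean μ‖ +
        ENNReal.ofReal (Real.sqrt (2 * Real.log (1 + cFour * frob (truncCov μ) ^ 2))) := by
  have hT := measurable_truncCentred μ
  have hp0 : ENNReal.ofReal p ≠ 0 := by simpa using zero_lt_one.trans_le hp
  obtain ⟨τ, h₁, h₂, h⟩ := exists_coupling_truncCentred hi
  have hg : Measurable fun z : EuclideanSpace ℝ (Fin d) × EuclideanSpace ℝ (Fin d) =>
      truncCentred μ z.1 + z.2 := by fun_prop
  obtain ⟨ρ, hρ, hρ₁, hρ₂⟩ := exists_glued_measure hg h₁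
  have hu : ρ.map (fun w => w.1.1 + w.1.2) = μ ∗ stdGaussian d := by
    rw [Measure.conv, ← hρ₁, Measure.map_map (by fun_prop) measurable_fst]
    rfl
  have hv : ρ.map Prod.snd = stdGaussian d := by
    rw [← h₂, ← hρ₂, Measure.map_map measurable_snd (by fun_prop)]
    rfl
  have hμ : ρ.map (fun w => w.1.1) = μ := by
    have : (μ.prod (stdGaussian d)).map Prod.fst = μ := by simp
    rw [← this, ← hρ₁, Measure.map_map measurable_fst measurable_fst]
    rfl
  have hW := Wp_map_le_eLpNorm (ρ := ρ) (u := fun w => w.1.1 + w.1.2) (v := Prod.snd)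
    (by fun_prop) measurable_snd (zero_lt_one.trans_le hp)
  rw [hu, hv] at hW
  have hsplit : (fun w : (EuclideanSpace ℝ (Fin d) × EuclideanSpace ℝ (Fin d)) ×
      EuclideanSpace ℝ (Fin d) => w.1.1 + w.1.2 - w.2) =
      ((fun w => tailPart w.1.1) + fun _ => truncMean μ) +
        fun w => truncCentred μ w.1.1 + w.1.2 - w.2 := by
    ext1 w
    have h3 := tailPart_add_truncMean_add_truncCentred μ w.1.1
    simp only [Pi.add_apply]
    nth_rewrite 1 [← h3]
    abel
  have h1p : 1 ≤ ENNReal.ofReal p := by simpa using hp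
  have htail : Measurable fun w : (EuclideanSpace ℝ (Fin d) × EuclideanSpace ℝ (Fin d)) ×
      EuclideanSpace ℝ (Fin d) => tailPart w.1.1 :=
    measurable_tailPart.comp (measurable_fst.comp measurable_fst)
  rw [hsplit] at hW
  refine hW.trans ((eLpNorm_add_le (htail.add_const _).aestronglyMeasurable (by fun_prop)
    h1p).trans (add_le_add ((eLpNorm_add_le htail.aestronglyMeasurable (by fun_prop)
    h1p).trans (add_le_add ?_ ?_)) ?_))
  · conv_rhs => rw [← hμ]
    rw [eLpNorm_map_measure measurable_tailPart.aestronglyMeasurable (by fun_prop)]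
    rfl
  · rw [eLpNorm_const _ hp0 (NeZero.ne ρ), ofReal_norm]
    simp
  · refine le_trans ?_ h
    rw [← hρ₂, eLpNorm_map_measure (by fun_prop) (by fun_prop)]
    refine eLpNorm_le_eLpNorm_of_exponent_le ?_ (by fun_prop)
    simpa using ENNReal.ofReal_le_ofReal hp2

end Truncation

end GaussianTransport

/-- refined `W₁`/`W₂` Gaussian convolution inequality with tail and
truncated-covariance terms. -/
theorem wasserstein_gaussian_convolution_refined
    (d : ℕ) (μ : Measure (EuclideanSpace ℝ (Fin d))) [IsProbabilityMeasure μ]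
    (hmean : ∫ x, x ∂μ = 0)
    (hmom : Integrable (fun x => ‖x‖ ^ 2) μ) :
    Wp 1 (μ ∗ stdGaussian d) (stdGaussian d) ≤
        ENNReal.ofReal ((tailOne μ + min 1 (tailOne μ)) +
          Real.sqrt (2 * Real.log (1 + cFour * frob (truncCov μ) ^ 2))) ∧
    Wp 2 (μ ∗ stdGaussian d) (stdGaussian d) ≤
        ENNReal.ofReal ((tailTwo μ + min 1 (tailTwo μ)) +
          Real.sqrt (2 * Real.log (1 + cFour * frob (truncCov μ) ^ 2))) ∧
    Wp 1 (μ ∗ stdGaussian d) (stdGaussian d) ≤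
        ENNReal.ofReal (2 * tailOne μ +
          Real.sqrt (2 * Real.log (1 + cFour * frob (truncCov μ) ^ 2))) ∧
    Wp 2 (μ ∗ stdGaussian d) (stdGaussian d) ≤
        ENNReal.ofReal (2 * tailTwo μ +
          Real.sqrt (2 * Real.log (1 + cFour * frob (truncCov μ) ^ 2))) := by
  have hi := integrable_norm_of_sq hmom
  have hm1 := norm_truncMean_le_tailOne hmean hi
  have hm2 := hm1.trans (tailOne_le_tailTwo hmom)
  have hm := norm_truncMean_le_one (μ := μ)
  have h1 := Wp_conv_stdGaussian_le hi le_rfl one_le_two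
  have h2 := Wp_conv_stdGaussian_le hi one_le_two le_rfl
  have ht1 := tailOne_nonneg μ
  have ht2 : 0 ≤ tailTwo μ := Real.sqrt_nonneg _
  rw [ENNReal.ofReal_one, eLpNorm_one_tailPart hi, ← ENNReal.ofReal_add ht1 (norm_nonneg _),
    ← ENNReal.ofReal_add (add_nonneg ht1 (norm_nonneg _)) (Real.sqrt_nonneg _)] at h1
  rw [ENNReal.ofReal_ofNat, eLpNorm_two_tailPart hmom, ← ENNReal.ofReal_add ht2 (norm_nonneg _),
    ← ENNReal.ofReal_add (add_nonneg ht2 (norm_nonneg _)) (Real.sqrt_nonneg _)] at h2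
  refine ⟨h1.trans (ENNReal.ofReal_le_ofReal ?_), h2.trans (ENNReal.ofReal_le_ofReal ?_),
    h1.trans (ENNReal.ofReal_le_ofReal ?_), h2.trans (ENNReal.ofReal_le_ofReal ?_)⟩
  · linarith [le_min hm hm1]
  · linarith [le_min hm hm2]
  · linarith
  · linarith

end
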